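/- arXiv:math/0302172 — 5 statements merged into one kernel-verified Lean document; each statement's English description precedes it below -/
import Mathlib

section
/- (Mallows–Sloane bound, Type II) If C is a binary self-dual code of length n > 0 (that is, C = C⊥ in F_2^n) in which every codeword has Hamming weight divisible by 4, then its minimum distance satisfies d ≤ 4·⌊n/24⌋ + 4. -/
open Finset Polynomial

noncomputable section

variable {F : Type*} [Field F] [Fintype F] {ι : Type*} [Fintype ι]

/-- Hamming weight of a vector. -/
def wt (x : ι → F) : ℕ := Set.ncard {i | x i ≠ 0}

/-- The dual code with respect to the standard bilinear form. -/
def dualCode (Γ : Submodule F (ι → F)) : Submodule F (ι → F) where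
  carrier := {x | ∀ c ∈ Γ, ∑ i, x i * c i = 0}
  zero_mem' := by intro c hc; simp
  add_mem' := by
    intro a b ha hb c hc
    simp [Pi.add_apply, add_mul, Finset.sum_add_distrib, ha c hc, hb c hc]
  smul_mem' := by
    intro r a ha c hc
    simp [Pi.smul_apply, smul_eq_mul, mul_assoc, ← Finset.mul_sum, ha c hc]

/-- Minimum distance: the least Hamming weight of a nonzero codeword. -/
def minDist (Γ : Submodule F (ι → F)) : ℕ := sInf {w | ∃ x ∈ Γ, x ≠ 0 ∧ wt x = w}

/-- Number of codewords of weight `i`. -/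
def wtCount (Γ : Submodule F (ι → F)) (i : ℕ) : ℕ := Set.ncard {x | x ∈ Γ ∧ wt x = i}

/-- Vectors supported inside a set `S` of coordinates. -/
def supportedOn (F : Type*) [Field F] {ι : Type*} (S : Finset ι) : Submodule F (ι → F) where
  carrier := {x | ∀ i ∉ S, x i = 0}
  zero_mem' := by intro i hi; rfl
  add_mem' := by intro a b ha hb i hi; simp [Pi.add_apply, ha i hi, hb i hi]
  smul_mem' := by intro r a ha i hi; simp [Pi.smul_apply, ha i hi]

/-- The rank function: dimension of the projection of the code to coordinates in `S`. -/
def projRank (Γ : Submodule F (ι → F)) (S : Finset ι) : ℕ :=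
  Module.finrank F (Γ.map (LinearMap.funLeft F F (Subtype.val : {i // i ∈ S} → ι)))

/-- Generalized binomial coefficient `x(x-1)⋯(x-m+1)/m!`. -/
def genBinom (x : ℚ) (m : ℕ) : ℚ := (descPochhammer ℚ m).eval x / m.factorial

/-- The congruence defining the zeta polynomial of a code. -/
def zetaCongr (q n d : ℕ) (a : ℕ → ℚ) (P : ℚ[X]) : Prop :=
  (X : ℚ[X]) ^ (n - d + 1) ∣
    P * (1 - X) ^ n -
      (1 - Polynomial.C (q : ℚ) * X) * Polynomial.C (((q : ℚ) - 1)⁻¹) *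
        ∑ w ∈ Finset.Icc d n, Polynomial.C (a w) * X ^ (w - d) * (1 - X) ^ (n - w)

/-- `P` is the zeta polynomial of a code with parameters `q, n, d` and
normalized weights `a`. -/
def IsZetaPoly (q n d : ℕ) (a : ℕ → ℚ) (P : ℚ[X]) : Prop :=
  P.natDegree ≤ n - d ∧ zetaCongr q n d a P

/-- Invariance (in the variable `z = y ^ 4`) of a weight enumerator of length `8 * N`. -/
def MSInv (N : ℕ) (p : ℝ[X]) : Prop :=
  p.natDegree ≤ 2 * N ∧ ∀ y : ℝ, y ≠ -1 →
    (1 + y) ^ (8 * N) * p.eval (((1 - y) / (1 + y)) ^ 4) = 16 ^ N * p.eval (y ^ 4)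

theorem MSInv.mul {N M : ℕ} {p q : ℝ[X]} (hp : MSInv N p) (hq : MSInv M q) :
    MSInv (N + M) (p * q) := by
  refine ⟨natDegree_mul_le.trans (by have := hp.1; have := hq.1; omega), fun y hy => ?_⟩
  have h1 := hp.2 y hy
  have h2 := hq.2 y hy
  rw [eval_mul, eval_mul]
  calc _ = ((1 + y) ^ (8 * N) * p.eval (((1 - y) / (1 + y)) ^ 4)) *
        ((1 + y) ^ (8 * M) * q.eval (((1 - y) / (1 + y)) ^ 4)) := by ring
    _ = _ := by rw [h1, h2]; ring

theorem MSInv.one : MSInv 0 1 := by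
  refine ⟨by simp, fun y hy => by simp⟩

theorem MSInv.pow {N : ℕ} {p : ℝ[X]} (hp : MSInv N p) (k : ℕ) : MSInv (k * N) (p ^ k) := by
  induction k with
  | zero => simpa using MSInv.one
  | succ k ih =>
    have := ih.mul hp
    rwa [pow_succ, Nat.succ_mul]

theorem MSInv.sub_smul {N : ℕ} {p q : ℝ[X]} (hp : MSInv N p) (hq : MSInv N q) (a : ℝ) :
    MSInv N (p - C a * q) := by
  refine ⟨(natDegree_sub_le _ _).trans (max_le hp.1 ((natDegree_C_mul_le _ _).trans hq.1)),
    fun y hy => ?_⟩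
  have h1 := hp.2 y hy
  have h2 := hq.2 y hy
  simp only [eval_sub, eval_mul, eval_C]
  linear_combination h1 - a * h2

/-- The weight enumerator of the extended Hamming code. -/
def msG : ℝ[X] := 1 + 14 * X + X ^ 2

/-- The degree 24 invariant. -/
def msD : ℝ[X] := X * (1 - X) ^ 4

theorem msG_inv : MSInv 1 msG := by
  refine ⟨by unfold msG; compute_degree, fun y hy => ?_⟩
  have : 1 + y ≠ 0 := fun h => hy (by linarith)
  simp only [msG, eval_add, eval_mul, eval_pow, eval_one, eval_X, eval_ofNat]
  field_simp
  ring

theorem msD_inv : MSInv 3 msD := by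
  refine ⟨by unfold msD; compute_degree!, fun y hy => ?_⟩
  have : 1 + y ≠ 0 := fun h => hy (by linarith)
  simp only [msD, eval_sub, eval_mul, eval_pow, eval_one, eval_X]
  have h : 1 - ((1 - y) / (1 + y)) ^ 4 = (8 * y * (1 + y ^ 2)) / (1 + y) ^ 4 := by
    field_simp
    ring
  rw [h]
  field_simp
  ring

theorem MSInv.reflect {N : ℕ} {p : ℝ[X]} (hp : MSInv N p) : p.reflect (2 * N) = p := by
  have key : ∀ y : ℝ, 0 < y → y ^ (8 * N) * p.eval ((y ^ 4)⁻¹) = p.eval (y ^ 4) := by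
    intro y hy
    have h1 := hp.2 y (by linarith)
    have hy1 : y + 1 ≠ 0 := by linarith
    have e1 : 1 + (y - 1) / (y + 1) = 2 * y / (y + 1) := by field_simp; ring
    have h2 := hp.2 ((y - 1) / (y + 1)) (by
      intro h
      rw [h] at e1
      have : 0 < 2 * y / (y + 1) := by positivity
      linarith)
    have e2 : (1 - (y - 1) / (y + 1)) / (1 + (y - 1) / (y + 1)) = y⁻¹ := by
      rw [e1]; field_simp; ring
    have e3 : ((y - 1) / (y + 1)) ^ 4 = ((1 - y) / (1 + y)) ^ 4 := by
      rw [add_comm 1 y]; field_simp; ring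
    rw [e2, e1, e3] at h2
    have h3 : (1 + y) ^ (8 * N) * (2 * y / (y + 1)) ^ (8 * N) = (256 : ℝ) ^ N * y ^ (8 * N) := by
      rw [← mul_pow, show (1 + y) * (2 * y / (y + 1)) = 2 * y by field_simp; ring, mul_pow,
        pow_mul 2 8 N]
      norm_num
    have h4 : (256 : ℝ) ^ N = 16 ^ N * 16 ^ N := by rw [← mul_pow]; norm_num
    have h5 : (16 : ℝ) ^ N ≠ 0 := by positivity
    rw [inv_pow] at h2
    have : (16 ^ N * 16 ^ N) * (y ^ (8 * N) * p.eval ((y ^ 4)⁻¹))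
        = (16 ^ N * 16 ^ N) * p.eval (y ^ 4) := by
      rw [← h4]
      linear_combination (1 + y) ^ (8 * N) * h2 + 16 ^ N * h1 - (p.eval ((y ^ 4)⁻¹)) * h3
        - h4 * p.eval (y ^ 4)
    exact mul_left_cancel₀ (mul_ne_zero h5 h5) this
  refine Polynomial.eq_of_infinite_eval_eq _ _ ((Set.Ioi_infinite (0 : ℝ)).mono ?_)
  intro z hz
  have hz : 0 < z := hz
  obtain ⟨y, hy, rfl⟩ : ∃ y : ℝ, 0 < y ∧ y ^ 4 = z := by
    refine ⟨Real.sqrt (Real.sqrt z), by positivity, ?_⟩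
    rw [show 4 = 2 * 2 from rfl, pow_mul, Real.sq_sqrt (by positivity), Real.sq_sqrt hz.le]
  have h1 := key y hy
  have hi : Invertible ((y ^ 4)⁻¹ : ℝ) := invertibleOfNonzero (by positivity)
  have h2 := eval₂_reflect_mul_pow (RingHom.id ℝ) ((y ^ 4)⁻¹) (2 * N) p hp.1
  simp only [invOf_eq_inv, inv_inv] at h2
  change eval _ _ = eval _ _
  rw [← h1]
  change eval (y ^ 4) _ * _ = eval _ p at h2
  rw [← h2]
  have : y ^ (8 * N) * ((y ^ 4)⁻¹) ^ (2 * N) = 1 := by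
    rw [inv_pow, ← pow_mul, show 4 * (2 * N) = 8 * N by ring]
    exact mul_inv_cancel₀ (by positivity)
  linear_combination -eval (y ^ 4) (p.reflect (2 * N)) * this

theorem MSInv.one_mult {N m : ℕ} {p s : ℝ[X]} {a : ℕ} (hp : MSInv N p)
    (hX : (X : ℝ[X]) ^ (m + 1) ∣ p) (hs : p = (X - 1) ^ a * s) (hs1 : s.eval 1 ≠ 0) :
    4 * m + 4 ≤ a := by
  by_contra hlt
  obtain ⟨b, hb⟩ : ∃ b, 4 * m + 4 = a + (b + 1) := ⟨4 * m + 4 - a - 1, by omega⟩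
  obtain ⟨q, hq⟩ := hX
  have key : ∀ y : ℝ, y ≠ -1 → y ≠ 1 →
      16 ^ N * (((y + 1) * (y ^ 2 + 1)) ^ a * s.eval (y ^ 4)) =
      (1 + y) ^ (8 * N) * ((-1) ^ a * (1 - y) ^ (b + 1) / (1 + y) ^ (4 * m + 4) *
        q.eval (((1 - y) / (1 + y)) ^ 4)) := by
    intro y hy hy1
    have h := hp.2 y hy
    nth_rewrite 1 [hq] at h
    rw [hs] at h
    simp only [eval_mul, eval_pow, eval_sub, eval_one, eval_X] at h
    have h0 : 1 - y ≠ 0 := sub_ne_zero.2 (Ne.symm hy1)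
    rw [← pow_mul, show 4 * (m + 1) = 4 * m + 4 by ring, div_pow] at h
    rw [show (y ^ 4 - 1) = (-1) * ((1 - y) * ((y + 1) * (y ^ 2 + 1))) by ring] at h
    rw [mul_pow, mul_pow (1 - y)] at h
    nth_rewrite 1 [hb] at h
    rw [pow_add (1 - y)] at h
    have hm : ((-1 : ℝ) ^ a) * (-1) ^ a = 1 := by rw [← mul_pow]; norm_num
    refine mul_left_cancel₀ (pow_ne_zero a h0) ?_
    linear_combination -(-1) ^ a * h + (1 - y) ^ a * 16 ^ N *
      (((y + 1) * (y ^ 2 + 1)) ^ a * s.eval (y ^ 4)) * (-hm)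
  have hc1 : ContinuousAt (fun y : ℝ => 16 ^ N * (((y + 1) * (y ^ 2 + 1)) ^ a *
      s.eval (y ^ 4))) 1 := by
    have := s.continuous
    fun_prop
  have hc2 : ContinuousAt (fun y : ℝ => (1 + y) ^ (8 * N) * ((-1) ^ a * (1 - y) ^ (b + 1) /
      (1 + y) ^ (4 * m + 4) * q.eval (((1 - y) / (1 + y)) ^ 4))) 1 := by
    have hq := q.continuous
    have h1 : (1 + (1 : ℝ)) ≠ 0 := by norm_num
    have h2 : (1 + (1 : ℝ)) ^ (4 * m + 4) ≠ 0 := by positivity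
    have : ContinuousAt (fun y : ℝ => q.eval (((1 - y) / (1 + y)) ^ 4)) 1 := by
      apply ContinuousAt.comp (g := fun z => q.eval z) (f := fun y : ℝ => ((1 - y) / (1 + y)) ^ 4)
      · exact hq.continuousAt
      · fun_prop (disch := assumption)
    fun_prop (disch := assumption)
  have hev : (fun y : ℝ => 16 ^ N * (((y + 1) * (y ^ 2 + 1)) ^ a * s.eval (y ^ 4)))
      =ᶠ[nhdsWithin 1 {1}ᶜ] (fun y : ℝ => (1 + y) ^ (8 * N) * ((-1) ^ a * (1 - y) ^ (b + 1) /
      (1 + y) ^ (4 * m + 4) * q.eval (((1 - y) / (1 + y)) ^ 4))) := by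
    have h1 : ∀ᶠ y : ℝ in nhdsWithin 1 {1}ᶜ, y ≠ -1 :=
      (eventually_ne_nhds (by norm_num : (1 : ℝ) ≠ -1)).filter_mono nhdsWithin_le_nhds
    filter_upwards [h1, self_mem_nhdsWithin] with y hy hy1
    exact key y hy hy1
  have hl1 := (hc1.tendsto.mono_left (nhdsWithin_le_nhds (s := {1}ᶜ))).congr' hev
  have hl2 := hc2.tendsto.mono_left (nhdsWithin_le_nhds (s := {1}ᶜ))
  have h := tendsto_nhds_unique hl1 hl2
  norm_num at h
  exact hs1 h

theorem MSInv.eq_zero {N m : ℕ} {p : ℝ[X]} (hp : MSInv N p) (hN : N < 3 * (m + 1))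
    (hX : (X : ℝ[X]) ^ (m + 1) ∣ p) : p = 0 := by
  by_contra h0
  obtain ⟨s, hs, hs1⟩ := exists_eq_pow_rootMultiplicity_mul_and_not_dvd p h0 1
  rw [dvd_iff_isRoot] at hs1
  have hm := hp.one_mult hX (by simpa using hs) hs1
  have hd : ((X : ℝ[X]) - 1) ^ (4 * m + 4) ∣ p := by
    rw [hs]
    exact Dvd.dvd.mul_right (by simpa using pow_dvd_pow _ hm) _
  have hcop : IsCoprime ((X : ℝ[X]) ^ (m + 1)) ((X - 1) ^ (4 * m + 4)) :=
    IsCoprime.pow ⟨1, -1, by ring⟩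
  have hdeg := natDegree_le_of_dvd (hcop.mul_dvd hX hd) h0
  have e : ((X : ℝ[X]) - 1) = X - C 1 := by simp
  rw [e, ((monic_X_pow _).natDegree_mul ((monic_X_sub_C 1).pow _)), natDegree_X_pow,
    (monic_X_sub_C 1).natDegree_pow, natDegree_X_sub_C] at hdeg
  have hr := congrArg (fun f => f.coeff (2 * N - p.natDegree)) hp.reflect
  simp only [coeff_reflect] at hr
  have hle := hp.1
  rw [revAt_le (by omega), show 2 * N - (2 * N - p.natDegree) = p.natDegree by omega] at hr
  have hne : p.coeff p.natDegree ≠ 0 := by simpa using h0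
  rw [X_pow_dvd_iff] at hX
  have := hX (2 * N - p.natDegree)
  by_cases hlt : 2 * N - p.natDegree < m + 1
  · exact hne (hr.trans (this hlt))
  · omega

/-- The geometric series `1 / (1 - X)`. -/
def msE : PowerSeries ℝ := PowerSeries.mk 1

theorem msE_mul : (1 - PowerSeries.X) * msE = 1 := by
  rw [mul_comm]; exact PowerSeries.mk_one_mul_one_sub_eq_one ℝ

theorem msE_mul_pow (k l : ℕ) :
    (1 - PowerSeries.X) ^ k * msE ^ (k + l) = msE ^ l := by
  rw [pow_add, ← mul_assoc, ← mul_pow, msE_mul, one_pow, one_mul]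

theorem msE_deriv : PowerSeries.derivative ℝ msE = msE ^ 2 := by
  have h := congrArg (PowerSeries.derivative ℝ) msE_mul
  simp only [Derivation.leibniz, map_sub, PowerSeries.derivative_X, Derivation.map_one_eq_zero,
    smul_eq_mul] at h
  linear_combination (-PowerSeries.derivative ℝ msE) * msE_mul + msE * h

/-- The power series `1 + 14 X + X ^ 2`. -/
def msH : PowerSeries ℝ := 1 + 14 * PowerSeries.X + PowerSeries.X ^ 2

/-- Its derivative. -/
def msH' : PowerSeries ℝ := 14 + 2 * PowerSeries.X

/-- The degree 12 relative invariant. -/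
def msK : PowerSeries ℝ :=
  1 - 33 * PowerSeries.X - 33 * PowerSeries.X ^ 2 + PowerSeries.X ^ 3

theorem msH_deriv : PowerSeries.derivative ℝ msH = msH' := by
  have h14 : PowerSeries.derivative ℝ (14 : PowerSeries ℝ) = 0 :=
    Derivation.map_natCast (PowerSeries.derivative ℝ) 14
  simp only [msH, msH', Derivation.leibniz, Derivation.leibniz_pow, map_add,
    PowerSeries.derivative_X, Derivation.map_one_eq_zero, smul_eq_mul, h14]
  simp

theorem ms_coeff (h : PowerSeries ℝ) (k : ℕ) :
    PowerSeries.coeff k (PowerSeries.X * PowerSeries.derivative ℝ h - (k : PowerSeries ℝ) * h)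
      = 0 := by
  have e : (k : PowerSeries ℝ) = PowerSeries.C (k : ℝ) := by simp
  rw [map_sub, e, PowerSeries.coeff_C_mul]
  cases k with
  | zero => simp
  | succ k =>
    rw [PowerSeries.coeff_succ_X_mul, PowerSeries.coeff_derivative]
    push_cast
    ring

theorem ms_ident (a b k : ℕ) :
    PowerSeries.X * PowerSeries.derivative ℝ (msH ^ (a + 1) * msE ^ b)
      - (k : PowerSeries ℝ) * (msH ^ (a + 1) * msE ^ b) =
    msH ^ a * msE ^ (b + 1) * (((a + 1 : ℕ) : PowerSeries ℝ) * PowerSeries.X * msH' * (1 - PowerSeries.X)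
      + (b : PowerSeries ℝ) * PowerSeries.X * msH - (k : PowerSeries ℝ) * (1 - PowerSeries.X) * msH) := by
  have hb : PowerSeries.derivative ℝ (msE ^ b) = b * msE ^ (b + 1) := by
    rw [Derivation.leibniz_pow, msE_deriv]
    cases b with
    | zero => simp
    | succ b => simp only [smul_eq_mul, nsmul_eq_mul, Nat.add_sub_cancel]; ring
  rw [Derivation.leibniz, hb, Derivation.leibniz_pow, msH_deriv]
  simp only [smul_eq_mul, nsmul_eq_mul, Nat.add_sub_cancel]
  have h := msE_mul_pow 1 b
  rw [pow_one, add_comm 1 b] at h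
  linear_combination (-msH ^ a * (((a + 1 : ℕ) : PowerSeries ℝ) * PowerSeries.X * msH' - k * msH)) * h

theorem ms_coeff_zero (i : ℕ) :
    PowerSeries.coeff (i + 1) (msH ^ (3 * i + 2) * msE ^ (4 * i + 5) * msK) = 0 := by
  have h := ms_coeff (msH ^ (3 * i + 2 + 1) * msE ^ (4 * i + 4)) (i + 1)
  rw [ms_ident] at h
  have e : msH ^ (3 * i + 2) * msE ^ (4 * i + 4 + 1) *
      (((3 * i + 2 + 1 : ℕ) : PowerSeries ℝ) * PowerSeries.X * msH' * (1 - PowerSeries.X)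
      + ((4 * i + 4 : ℕ) : PowerSeries ℝ) * PowerSeries.X * msH - ((i + 1 : ℕ) : PowerSeries ℝ) * (1 - PowerSeries.X) * msH) =
      PowerSeries.C (-((i : ℝ) + 1)) * (msH ^ (3 * i + 2) * msE ^ (4 * i + 5) * msK) := by
    have : PowerSeries.C (-((i : ℝ) + 1)) = -((i : PowerSeries ℝ) + 1) := by simp
    rw [this]
    simp only [msH', msK]
    nth_rewrite 2 3 [msH]
    push_cast
    ring
  rw [e, PowerSeries.coeff_C_mul] at h
  rcases mul_eq_zero.1 h with h | h
  · exfalso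
    have : (0 : ℝ) ≤ i := Nat.cast_nonneg i
    linarith
  · exact h

/-- Nonnegative coefficients and positive constant term. -/
def MSPos (f : PowerSeries ℝ) : Prop :=
  (∀ k, 0 ≤ PowerSeries.coeff k f) ∧ 0 < PowerSeries.coeff 0 f

theorem MSPos.mul {f g : PowerSeries ℝ} (hf : MSPos f) (hg : MSPos g) : MSPos (f * g) := by
  refine ⟨fun k => ?_, ?_⟩
  · rw [PowerSeries.coeff_mul]
    exact Finset.sum_nonneg fun x _ => mul_nonneg (hf.1 _) (hg.1 _)
  · rw [PowerSeries.coeff_mul]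
    simpa using mul_pos hf.2 hg.2

theorem MSPos.one : MSPos 1 := by
  refine ⟨fun k => ?_, by simp⟩
  rw [PowerSeries.coeff_one]
  split_ifs <;> norm_num

theorem MSPos.pow {f : PowerSeries ℝ} (hf : MSPos f) (k : ℕ) : MSPos (f ^ k) := by
  induction k with
  | zero => simpa using MSPos.one
  | succ k ih => rw [pow_succ]; exact ih.mul hf

theorem msE_pos : MSPos msE := ⟨fun k => by simp [msE], by simp [msE]⟩

theorem MSPos.msE_mul {f : PowerSeries ℝ} (hf : MSPos f) (k : ℕ) :
    0 < PowerSeries.coeff k (f * msE) := by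
  rw [PowerSeries.coeff_mul]
  refine Finset.sum_pos' (fun x _ => mul_nonneg (hf.1 _) (msE_pos.1 _)) ⟨(0, k), by simp, ?_⟩
  simpa [msE] using hf.2

theorem ms_poly_pos (p : ℕ → ℝ) (f : PowerSeries ℝ) (hf : ∀ k, PowerSeries.coeff k f = p k)
    (h0 : 0 < p 0) (h : ∀ k, 0 ≤ p k) : MSPos f :=
  ⟨fun k => by rw [hf]; exact h k, by rw [hf]; exact h0⟩

theorem msH_pos : MSPos msH := by
  have e : (14 : PowerSeries ℝ) = PowerSeries.C (14 : ℝ) := (map_ofNat PowerSeries.C 14).symm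
  refine ⟨fun k => ?_, ?_⟩
  · simp only [msH, e, map_add, PowerSeries.coeff_C_mul, PowerSeries.coeff_one,
      PowerSeries.coeff_X, PowerSeries.coeff_X_pow]
    split_ifs <;> norm_num
  · simp [msH]

theorem msH'_pos : MSPos msH' := by
  have e : (14 : PowerSeries ℝ) = PowerSeries.C (14 : ℝ) := (map_ofNat PowerSeries.C 14).symm
  have e2 : (2 : PowerSeries ℝ) = PowerSeries.C (2 : ℝ) := (map_ofNat PowerSeries.C 2).symm
  refine ⟨fun k => ?_, ?_⟩
  · simp only [msH', e, e2, map_add, PowerSeries.coeff_C_mul, PowerSeries.coeff_C,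
      PowerSeries.coeff_X]
    split_ifs <;> norm_num
  · simp [msH', e]

theorem ms_coeff_neg (m r t : ℕ) (ht : t + r = 2) (hpos : 0 < 3 * m + r) :
    PowerSeries.coeff (m + 1) (msH ^ t * msE ^ (4 * m + 5) * msK) < 0 := by
  have h := ms_coeff (msH ^ (t + 1) * msE ^ (4 * m + 4)) (m + 1)
  rw [ms_ident] at h
  have e : msH ^ t * msE ^ (4 * m + 4 + 1) *
      (((t + 1 : ℕ) : PowerSeries ℝ) * PowerSeries.X * msH' * (1 - PowerSeries.X)
      + ((4 * m + 4 : ℕ) : PowerSeries ℝ) * PowerSeries.X * msH - ((m + 1 : ℕ) : PowerSeries ℝ) * (1 - PowerSeries.X) * msH) =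
      PowerSeries.C (-((m : ℝ) + 1)) * (msH ^ t * msE ^ (4 * m + 5) * msK) -
      PowerSeries.C (3 * (m : ℝ) + r) *
        (PowerSeries.X * (msH ^ t * msH' * msE ^ (4 * m + 3) * msE)) := by
    have h1 : PowerSeries.C (-((m : ℝ) + 1)) = -((m : PowerSeries ℝ) + 1) := by simp
    have h2 : PowerSeries.C (3 * (m : ℝ) + r) = 3 * (m : PowerSeries ℝ) + r := by
      rw [map_add, map_mul, map_ofNat, map_natCast, map_natCast]
    have ht' : (t : PowerSeries ℝ) + r = 2 := by
      rw [← Nat.cast_add, ht]; rfl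
    have hE := msE_mul_pow 1 (4 * m + 4)
    rw [pow_one, add_comm 1 (4 * m + 4)] at hE
    have hE2 : msE ^ (4 * m + 3) * msE = msE ^ (4 * m + 4) := by rw [← pow_succ]
    rw [h1, h2, mul_assoc (msH ^ t * msH'), hE2, ← hE]
    simp only [msH', msK]
    have : (msH : PowerSeries ℝ) = 1 + 14 * PowerSeries.X + PowerSeries.X ^ 2 := rfl
    push_cast
    rw [eq_sub_of_add_eq ht']
    generalize msH ^ t = u
    rw [this]
    ring
  rw [e, map_sub, PowerSeries.coeff_C_mul, PowerSeries.coeff_C_mul,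
    PowerSeries.coeff_succ_X_mul] at h
  have hp : 0 < PowerSeries.coeff m (msH ^ t * msH' * msE ^ (4 * m + 3) * msE) :=
    (((msH_pos.pow t).mul msH'_pos).mul (msE_pos.pow _)).msE_mul m
  have h3 : (0 : ℝ) < 3 * m + r := by exact_mod_cast hpos
  have h4 : (0 : ℝ) < m + 1 := by positivity
  have h5 := mul_pos h3 hp
  by_contra hc
  push Not at hc
  have := mul_nonneg h4.le hc
  linarith

theorem ms_wt_eq {n : ℕ} (x : Fin n → ZMod 2) : wt x = #{i | x i ≠ 0} := by
  rw [wt, Set.ncard_eq_toFinset_card']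
  congr 1
  ext i
  simp

theorem ms_wt_le {n : ℕ} (x : Fin n → ZMod 2) : wt x ≤ n := by
  rw [ms_wt_eq]
  exact (Finset.card_le_univ _).trans (by simp)

theorem ms_prod {n : ℕ} {K : Type*} [CommRing K] (x : Fin n → ZMod 2) (a b : K) :
    ∏ i, (if x i = 0 then a else b) = b ^ wt x * a ^ (n - wt x) := by
  rw [Finset.prod_ite, Finset.prod_const, Finset.prod_const, ms_wt_eq, mul_comm]
  congr 2
  have := Finset.card_filter_add_card_filter_not (s := (univ : Finset (Fin n))) (fun i => x i = 0)
  simp only [card_univ, Fintype.card_fin] at this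
  simp only [ne_eq]
  omega

/-- The nontrivial character of `ZMod 2`. -/
def msChi (K : Type*) [CommRing K] (a : ZMod 2) : K := if a = 0 then 1 else -1

theorem msChi_add {K : Type*} [CommRing K] (a b : ZMod 2) :
    msChi K (a + b) = msChi K a * msChi K b := by
  have h : ∀ a b : ZMod 2, a + b = 0 ↔ (a = 0 ↔ b = 0) := by decide
  simp only [msChi, h]
  by_cases ha : a = 0 <;> by_cases hb : b = 0 <;> simp [ha, hb]

theorem msChi_sum {K : Type*} [CommRing K] {n : ℕ} (f : Fin n → ZMod 2) :
    msChi K (∑ i, f i) = ∏ i, msChi K (f i) := by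
  let φ : Multiplicative (ZMod 2) →* K :=
    { toFun := fun a => msChi K a.toAdd
      map_one' := by simp [msChi]
      map_mul' := fun a b => msChi_add _ _ }
  have := map_prod φ (fun i => Multiplicative.ofAdd (f i)) univ
  rw [← ofAdd_sum] at this
  exact this

open Classical in
theorem ms_orth {K : Type*} [Field K] [CharZero K] {n : ℕ}
    (Γ : Submodule (ZMod 2) (Fin n → ZMod 2)) (v : Fin n → ZMod 2) :
    ∑ c : Γ, msChi K (∑ i, v i * c.1 i) = if v ∈ dualCode Γ then (Fintype.card Γ : K) else 0 := by
  split_ifs with hv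
  · have : ∀ c : Γ, msChi K (∑ i, v i * c.1 i) = 1 := fun c => by
      rw [hv c.1 c.2]; simp [msChi]
    simp [this]
  · have : ∃ d ∈ Γ, ∑ i, v i * d i ≠ 0 := by
      by_contra h
      push Not at h
      exact hv h
    obtain ⟨d, hd, hd0⟩ := this
    have h1 : ∑ c : Γ, msChi K (∑ i, v i * c.1 i) = ∑ c : Γ, -msChi K (∑ i, v i * c.1 i) := by
      rw [← Equiv.sum_comp (Equiv.addRight (⟨d, hd⟩ : Γ))]
      refine Finset.sum_congr rfl fun c _ => ?_
      simp only [Equiv.coe_addRight, Submodule.coe_add, Pi.add_apply, mul_add,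
        Finset.sum_add_distrib, msChi_add]
      rw [msChi, msChi, if_neg hd0]
      ring
    rw [Finset.sum_neg_distrib] at h1
    exact self_eq_neg.1 h1

open Classical in
theorem ms_macwilliams {K : Type*} [Field K] [CharZero K] {n : ℕ}
    (Γ : Submodule (ZMod 2) (Fin n → ZMod 2)) (hsd : Γ = dualCode Γ) (y : K) :
    ∑ c : Γ, (1 - y) ^ wt c.1 * (1 + y) ^ (n - wt c.1) =
      (Fintype.card Γ : K) * ∑ c : Γ, y ^ wt c.1 := by
  have h1 : ∀ c : Γ, (1 - y) ^ wt c.1 * (1 + y) ^ (n - wt c.1) =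
      ∑ v : Fin n → ZMod 2, msChi K (∑ i, v i * c.1 i) * y ^ wt v := by
    intro c
    rw [← ms_prod]
    have : ∀ i, (if c.1 i = 0 then 1 + y else 1 - y) =
        ∑ a : ZMod 2, msChi K (a * c.1 i) * (if a = 0 then 1 else y) := by
      intro i
      rw [show (univ : Finset (ZMod 2)) = {0, 1} from rfl, Finset.sum_pair (by decide)]
      by_cases h : c.1 i = 0
      · simp [h, msChi]
      · simp [h, msChi]; ring
    simp only [this]
    rw [Finset.prod_univ_sum, Fintype.piFinset_univ]
    refine Finset.sum_congr rfl fun v _ => ?_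
    rw [Finset.prod_mul_distrib, ms_prod, one_pow, mul_one, msChi_sum]
  simp only [h1]
  rw [Finset.sum_comm]
  simp only [← Finset.sum_mul, ms_orth, ← hsd]
  simp only [ite_mul, zero_mul]
  rw [← Finset.sum_filter, ← Finset.mul_sum]
  congr 1
  exact Finset.sum_subtype _ (by simp) _

open Classical in
theorem ms_card {n : ℕ} (Γ : Submodule (ZMod 2) (Fin n → ZMod 2)) (hsd : Γ = dualCode Γ) :
    Fintype.card Γ ^ 2 = 2 ^ n := by
  have h := ms_macwilliams (K := ℚ) Γ hsd 1
  rw [Finset.sum_eq_single (0 : Γ)] at h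
  · have h0 : wt (0 : Fin n → ZMod 2) = 0 := by simp [wt]
    simp only [Submodule.coe_zero, h0, sub_self, one_pow] at h
    norm_num at h
    rw [sq]
    exact_mod_cast h.symm
  · intro c _ hc
    have : wt c.1 ≠ 0 := by
      rw [ms_wt_eq]
      intro h0
      apply hc
      ext i
      rw [Finset.card_eq_zero, Finset.filter_eq_empty_iff] at h0
      simpa using h0 (Finset.mem_univ i)
    simp [this]
  · simp

open Classical in
theorem ms_length {n : ℕ} (Γ : Submodule (ZMod 2) (Fin n → ZMod 2)) (hsd : Γ = dualCode Γ)
    (hdiv : ∀ x ∈ Γ, 4 ∣ wt x) : ∃ N, n = 8 * N ∧ Fintype.card Γ = 16 ^ N := by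
  have hc := ms_card Γ hsd
  obtain ⟨k, -, hk⟩ := (Nat.dvd_prime_pow Nat.prime_two).1
    (Dvd.intro_left (Fintype.card Γ ^ 1) (by rw [← hc]; ring) : Fintype.card Γ ∣ 2 ^ n)
  rw [hk, ← pow_mul] at hc
  have hn : n = 2 * k := by
    have := Nat.pow_right_injective (le_refl 2) hc
    omega
  have h := ms_macwilliams (K := ℂ) Γ hsd Complex.I
  have hI : ∀ c : Γ, Complex.I ^ wt c.1 = 1 := fun c => by
    obtain ⟨j, hj⟩ := hdiv c.1 c.2
    rw [hj, pow_mul, Complex.I_pow_four, one_pow]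
  have hne : (1 + Complex.I) ≠ 0 := by
    intro h
    have := congrArg Complex.re h
    simp at this
  have hL : ∀ c : Γ, (1 - Complex.I) ^ wt c.1 * (1 + Complex.I) ^ (n - wt c.1) =
      (1 + Complex.I) ^ n := fun c => by
    obtain ⟨j, hj⟩ := hdiv c.1 c.2
    have hle := ms_wt_le c.1
    have e : (1 - Complex.I) ^ 4 = (1 + Complex.I) ^ 4 := by
      linear_combination (-8 * Complex.I) * Complex.I_sq
    obtain ⟨l, hl⟩ : ∃ l, l = n - wt c.1 := ⟨_, rfl⟩
    have hpow : (1 + Complex.I) ^ n = (1 + Complex.I) ^ wt c.1 * (1 + Complex.I) ^ l := by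
      rw [← pow_add]; congr 1; omega
    rw [← hl, hpow]
    congr 1
    rw [hj, pow_mul, e, pow_mul]
  simp only [hI, hL, Finset.sum_const, Finset.card_univ, nsmul_eq_mul, mul_one] at h
  have hcard : (Fintype.card Γ : ℂ) ≠ 0 := by
    rw [hk]; push_cast; exact pow_ne_zero _ two_ne_zero
  have h := mul_left_cancel₀ hcard h
  have e2 : (1 + Complex.I) ^ 2 = 2 * Complex.I := by
    linear_combination Complex.I_sq
  rw [hk, hn, pow_mul, e2, mul_pow] at h
  push_cast at h
  have hIk : Complex.I ^ k = 1 := by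
    refine mul_left_cancel₀ (pow_ne_zero k two_ne_zero) (h.trans (mul_one _).symm)
  have h4 : k % 4 = 0 := by
    have e3 : Complex.I ^ (k % 4) = 1 := by
      rw [← hIk]
      conv_rhs => rw [← Nat.div_add_mod k 4, pow_add, pow_mul, Complex.I_pow_four, one_pow, one_mul]
    have hlt : k % 4 < 4 := Nat.mod_lt _ (by norm_num)
    interval_cases hq : k % 4
    · rfl
    · have := congrArg Complex.re e3
      simp at this
    · have := congrArg Complex.re e3
      simp at this
      norm_num at this
    · have := congrArg Complex.re e3
      simp [pow_succ] at this
  obtain ⟨N, rfl⟩ := Nat.dvd_of_mod_eq_zero h4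
  exact ⟨N, by omega, by rw [hk, pow_mul]; norm_num⟩

/-- The functional which annihilates all invariants. -/
def msL (m t : ℕ) (p : ℝ[X]) : ℝ :=
  PowerSeries.coeff (m + 1) ((p : PowerSeries ℝ) * (msH ^ t * msE ^ (4 * m + 5) * msK))

theorem msG_coe : ((msG : ℝ[X]) : PowerSeries ℝ) = msH := by
  have e : (14 : ℝ[X]) = C 14 := (map_ofNat C 14).symm
  have e' : (14 : PowerSeries ℝ) = PowerSeries.C (14 : ℝ) := (map_ofNat PowerSeries.C 14).symm
  rw [msG, msH, e, e']
  simp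

theorem msD_coe : ((msD : ℝ[X]) : PowerSeries ℝ) = PowerSeries.X * (1 - PowerSeries.X) ^ 4 := by
  rw [msD]
  simp

theorem msL_basis (j i r t : ℕ) (ht : t + r = 2) :
    msL (i + j) t (msG ^ (3 * i + r) * msD ^ j) = 0 := by
  have h := ms_coeff_zero i
  rw [msL, Polynomial.coe_mul, Polynomial.coe_pow, Polynomial.coe_pow, msG_coe, msD_coe, mul_pow,
    ← pow_mul]
  have e := msE_mul_pow (4 * j) (4 * i + 5)
  have e2 : msH ^ (3 * i + r) * (PowerSeries.X ^ j * (1 - PowerSeries.X) ^ (4 * j)) *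
      (msH ^ t * msE ^ (4 * (i + j) + 5) * msK) =
      PowerSeries.X ^ j * (msH ^ (3 * i + 2) * msE ^ (4 * i + 5) * msK) := by
    rw [← e, ← ht, show 4 * (i + j) + 5 = 4 * j + (4 * i + 5) by ring]
    ring
  rw [e2, show i + j + 1 = i + 1 + j by ring, PowerSeries.coeff_X_pow_mul]
  exact h

theorem msL_zero (m r t : ℕ) (ht : t + r = 2) (d : ℕ) :
    ∀ k, k + d = m + 1 → ∀ p : ℝ[X], MSInv (3 * m + r) p → (X : ℝ[X]) ^ k ∣ p →
      msL m t p = 0 := by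
  induction d with
  | zero =>
    intro k hk p hp hX
    obtain rfl : k = m + 1 := by omega
    rw [hp.eq_zero (m := m) (by omega) hX]
    simp [msL]
  | succ d ih =>
    intro k hk p hp hX
    obtain ⟨q, hq⟩ := hX
    obtain ⟨i, rfl⟩ : ∃ i, m = i + k := ⟨d, by omega⟩
    have hb : MSInv (3 * (i + k) + r) (msG ^ (3 * i + r) * msD ^ k) := by
      have := (msG_inv.pow (3 * i + r)).mul (msD_inv.pow k)
      rwa [show (3 * i + r) * 1 + k * 3 = 3 * (i + k) + r by ring] at this
    have h := ih (k + 1) (by omega) _ (hp.sub_smul hb (q.eval 0)) (by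
      have e : p - C (q.eval 0) * (msG ^ (3 * i + r) * msD ^ k) =
          X ^ k * (q - C (q.eval 0) * (msG ^ (3 * i + r) * (1 - X) ^ (4 * k))) := by
        rw [hq, msD, mul_pow, ← pow_mul]
        ring
      rw [e, pow_succ]
      refine mul_dvd_mul_left _ ?_
      rw [X_dvd_iff, coeff_zero_eq_eval_zero]
      simp [msG])
    have hb0 := msL_basis k i r t ht
    simp only [msL] at h hb0 ⊢
    rw [Polynomial.coe_sub, Polynomial.coe_mul, Polynomial.coe_C, sub_mul, map_sub,
      mul_assoc (PowerSeries.C (q.eval 0)),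
      PowerSeries.coeff_C_mul, hb0] at h
    simpa using h

theorem ms_no_gap (m r : ℕ) (hr : r ≤ 2) (hpos : 0 < 3 * m + r) (p : ℝ[X])
    (hp : MSInv (3 * m + r) p) (hX : (X : ℝ[X]) ^ (m + 2) ∣ p - 1) : False := by
  obtain ⟨t, ht⟩ : ∃ t, t + r = 2 := ⟨2 - r, by omega⟩
  have h0 := msL_zero m r t ht (m + 1) 0 (by omega) p hp (by simp)
  have h1 := ms_coeff_neg m r t ht hpos
  obtain ⟨q, hq⟩ := hX
  have hq : p = 1 + X ^ (m + 2) * q := by rw [← hq]; ring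
  rw [msL, hq, Polynomial.coe_add, Polynomial.coe_mul, Polynomial.coe_pow, Polynomial.coe_X,
    Polynomial.coe_one, add_mul, one_mul, map_add, mul_assoc (PowerSeries.X ^ (m + 2)),
    PowerSeries.coeff_X_pow_mul'] at h0
  simp at h0
  linarith

open Classical in
theorem ms_enum {n N : ℕ} (Γ : Submodule (ZMod 2) (Fin n → ZMod 2)) (hsd : Γ = dualCode Γ)
    (hdiv : ∀ x ∈ Γ, 4 ∣ wt x) (hn : n = 8 * N) (hc : Fintype.card Γ = 16 ^ N) :
    MSInv N (∑ c : Γ, (X : ℝ[X]) ^ (wt c.1 / 4)) := by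
  refine ⟨natDegree_sum_le_of_forall_le _ _ fun c _ => ?_, fun y hy => ?_⟩
  · rw [natDegree_X_pow]
    have := ms_wt_le c.1
    omega
  · have h := ms_macwilliams (K := ℝ) Γ hsd y
    have hy1 : 1 + y ≠ 0 := fun h => hy (by linarith)
    have hw : ∀ c : Γ, 4 * (wt c.1 / 4) = wt c.1 := fun c => Nat.mul_div_cancel' (hdiv c.1 c.2)
    simp only [eval_finsetSum, eval_pow, eval_X, ← pow_mul, hw]
    rw [hc] at h
    push_cast at h
    rw [← h, Finset.mul_sum]
    refine Finset.sum_congr rfl fun c _ => ?_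
    have hle := ms_wt_le c.1
    obtain ⟨l, hl⟩ : ∃ l, l = n - wt c.1 := ⟨_, rfl⟩
    have hpow : (1 + y) ^ (8 * N) = (1 + y) ^ wt c.1 * (1 + y) ^ l := by
      rw [← pow_add]; congr 1; omega
    rw [← hl, hpow, div_pow]
    field_simp


/-- Mallows–Sloane, Type II: a binary self-dual code with all
weights divisible by 4 satisfies `d ≤ 4⌊n/24⌋ + 4`. -/
theorem stmt_13 {n : ℕ} (hn : 0 < n) (Γ : Submodule (ZMod 2) (Fin n → ZMod 2))
    (hsd : Γ = dualCode Γ) (hdiv : ∀ x ∈ Γ, 4 ∣ wt x) :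
    minDist Γ ≤ 4 * (n / 24) + 4 := by
  classical
  by_contra hlt
  push Not at hlt
  obtain ⟨N, hN, hc⟩ := ms_length Γ hsd hdiv
  have hinv := ms_enum Γ hsd hdiv hN hc
  obtain ⟨m, r, hr, hNm⟩ : ∃ m r, r ≤ 2 ∧ N = 3 * m + r :=
    ⟨N / 3, N % 3, by omega, by omega⟩
  have hm : n / 24 = m := by omega
  rw [hNm] at hinv
  refine ms_no_gap m r hr (by omega) _ hinv ?_
  rw [← Finset.add_sum_erase _ _ (Finset.mem_univ (0 : Γ))]
  have h0 : wt ((0 : Γ) : Fin n → ZMod 2) = 0 := by simp [wt]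
  rw [h0, Nat.zero_div, pow_zero, add_sub_cancel_left]
  refine Finset.dvd_sum fun c hc => pow_dvd_pow _ ?_
  have hc0 : c.1 ≠ 0 := by
    intro h
    exact (Finset.mem_erase.1 hc).1 (Subtype.ext h)
  have h1 : minDist Γ ≤ wt c.1 := Nat.sInf_le ⟨c.1, c.2, hc0, rfl⟩
  have h2 := hdiv c.1 c.2
  omega

end
end

section
/- (Mallows–Sloane bound, Type III) If C is a self-dual code of length n > 0 over F_3 (that is, C = C⊥ in F_3^n), then its minimum distance satisfies d ≤ 3·⌊n/12⌋ + 3. -/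
open Finset Polynomial

noncomputable section

variable {F : Type*} [Field F] [Fintype F] {ι : Type*} [Fintype ι]

theorem addChar_sum {R : Type*} [CommRing R] (ψ : AddChar (ZMod 3) R) {n : ℕ}
    (f : Fin n → ZMod 3) : ψ (∑ i, f i) = ∏ i, ψ (f i) := by
  have : ∀ s : Finset (Fin n), ψ (∑ i ∈ s, f i) = ∏ i ∈ s, ψ (f i) := by
    intro s
    induction s using Finset.induction_on with
    | empty => simp
    | insert a s ha ih =>
      rw [Finset.sum_insert ha, Finset.prod_insert ha, AddChar.map_add_eq_mul, ih]
  exact this univ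

open Classical in
/-- MacWilliams identity in product form. -/
theorem mac_prod {R : Type*} [CommRing R] [IsDomain R] {n : ℕ}
    (ψ : AddChar (ZMod 3) R) (hψ : ψ ≠ 1) (Γ : Submodule (ZMod 3) (Fin n → ZMod 3))
    (hsd : Γ = dualCode Γ) (m : ZMod 3 → R) :
    ∑ c : Γ, ∏ i, ∑ v, ψ (v * c.1 i) * m v =
      (Fintype.card Γ : R) * ∑ c : Γ, ∏ i, m (c.1 i) := by
  have h1 : ∀ c : Γ, ∏ i, ∑ v, ψ (v * c.1 i) * m v =
      ∑ u : Fin n → ZMod 3, ψ (∑ i, u i * c.1 i) * ∏ i, m (u i) := by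
    intro c
    rw [Finset.prod_univ_sum]
    rw [Fintype.piFinset_univ]
    refine Finset.sum_congr rfl fun u _ => ?_
    rw [Finset.prod_mul_distrib, addChar_sum]
  simp_rw [h1]
  rw [Finset.sum_comm]
  have h2 : ∀ u : Fin n → ZMod 3, ∑ c : Γ, ψ (∑ i, u i * c.1 i) * ∏ i, m (u i) =
      if u ∈ Γ then (Fintype.card Γ : R) * ∏ i, m (u i) else 0 := by
    intro u
    rw [← Finset.sum_mul]
    let χ : AddChar Γ R :=
      { toFun := fun c => ψ (∑ i, u i * c.1 i)
        map_zero_eq_one' := by simp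
        map_add_eq_mul' := by
          intro a b
          rw [← AddChar.map_add_eq_mul, ← Finset.sum_add_distrib]
          simp [mul_add] }
    have h3 : ∑ c : Γ, ψ (∑ i, u i * c.1 i) = ∑ c : Γ, χ c := rfl
    rw [h3, AddChar.sum_eq_ite]
    have h4 : χ = 0 ↔ u ∈ Γ := by
      constructor
      · intro h
        rw [hsd]
        intro c hc
        by_contra hne
        apply hψ
        ext t
        have h5 : χ ⟨(t / ∑ i, u i * c i) • c, Γ.smul_mem _ hc⟩ = 1 := by
          rw [h]; rfl
        have h6 : ψ (∑ i, u i * ((t / ∑ i, u i * c i) • c) i) = 1 := h5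
        have h7 : ∑ i, u i * ((t / ∑ i, u i * c i) • c) i = t := by
          have : ∀ i, u i * ((t / ∑ i, u i * c i) • c) i =
              (t / ∑ i, u i * c i) * (u i * c i) := by
            intro i; simp only [Pi.smul_apply, smul_eq_mul]; ring
          simp_rw [this]
          rw [← Finset.mul_sum, div_mul_cancel₀ _ hne]
        rw [h7] at h6
        simpa using h6
      · intro h
        rw [hsd] at h
        ext c
        have h5 : ∑ i, u i * c.1 i = 0 := h c.1 c.2
        have h6 : χ c = ψ (∑ i, u i * c.1 i) := rfl
        rw [h6, h5]; simp
    by_cases hu : u ∈ Γ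
    · simp [hu, h4]
    · simp [hu, h4]
  rw [Finset.sum_congr rfl fun u _ => h2 u, ← Finset.sum_filter, ← Finset.mul_sum]
  congr 1
  exact Finset.sum_subtype (p := fun u => u ∈ Γ) (univ.filter fun u => u ∈ Γ) (by simp) (fun u => ∏ i, m (u i))

theorem wt_eq_card {n : ℕ} (c : Fin n → ZMod 3) :
    wt c = (univ.filter fun i => c i ≠ 0).card := by
  rw [wt, ← Set.ncard_coe_finset]; simp

theorem prod_wt {R : Type*} [CommRing R] {n : ℕ} (c : Fin n → ZMod 3) (a b : R) :
    ∏ i, (if c i = 0 then a else b) = a ^ (n - wt c) * b ^ wt c := by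
  rw [Finset.prod_ite, Finset.prod_const, Finset.prod_const, wt_eq_card]
  congr 2
  have := Finset.card_filter_add_card_filter_not (s := (univ : Finset (Fin n))) (fun i => c i = 0)
  simp only [Finset.card_univ, Fintype.card_fin] at this
  simp only [ne_eq]
  omega

theorem wt_le {n : ℕ} (c : Fin n → ZMod 3) : wt c ≤ n := by
  rw [wt_eq_card]; exact (Finset.card_le_univ _).trans (by simp)

theorem wt_pos_of_ne {n : ℕ} (c : Fin n → ZMod 3) (h : wt c = 0) : c = 0 := by
  rw [wt_eq_card, Finset.card_eq_zero, Finset.filter_eq_empty_iff] at h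
  ext1 i; simpa using h (Finset.mem_univ i)

theorem three_dvd_wt {n : ℕ} (Γ : Submodule (ZMod 3) (Fin n → ZMod 3))
    (hsd : Γ = dualCode Γ) (c : Fin n → ZMod 3) (hc : c ∈ Γ) : 3 ∣ wt c := by
  have h1 : ∑ i, c i * c i = 0 := by
    have h := hc
    rw [hsd] at h
    exact h c hc
  have h2 : ∀ t : ZMod 3, t * t = if t ≠ 0 then 1 else 0 := by decide
  simp_rw [h2] at h1
  rw [Finset.sum_boole, ← wt_eq_card] at h1
  exact (ZMod.natCast_eq_zero_iff _ _).1 h1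

/-- The weight enumerator. -/
theorem mac_enum {n : ℕ} (Γ : Submodule (ZMod 3) (Fin n → ZMod 3)) [Fintype Γ]
    (hsd : Γ = dualCode Γ) (x y : MvPolynomial (Fin 2) ℂ) :
    ∑ c : Γ, (x + 2 * y) ^ (n - wt c.1) * (x - y) ^ wt c.1 =
      (Fintype.card Γ : MvPolynomial (Fin 2) ℂ) * ∑ c : Γ, x ^ (n - wt c.1) * y ^ wt c.1 := by
  classical
  let ψ : AddChar (ZMod 3) (MvPolynomial (Fin 2) ℂ) :=
    (MvPolynomial.C : ℂ →+* MvPolynomial (Fin 2) ℂ).toMonoidHom.compAddChar ZMod.stdAddChar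
  have hψv : ∀ t, ψ t = MvPolynomial.C (ZMod.stdAddChar t) := fun t => rfl
  have hψ1 : ψ 1 ≠ 1 := by
    rw [hψv]
    intro h
    have h1 : (ZMod.stdAddChar (1 : ZMod 3) : ℂ) = ZMod.stdAddChar (0 : ZMod 3) := by
      rw [AddChar.map_zero_eq_one]
      exact MvPolynomial.C_injective _ _ (by simpa using h)
    exact absurd (ZMod.injective_stdAddChar h1) (by decide)
  have hψ : ψ ≠ 1 := by
    intro h; apply hψ1; rw [h]; rfl
  have hs : ∑ t : ZMod 3, ψ t = 0 := AddChar.sum_eq_zero_of_ne_one hψ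
  have hs3 : 1 + ψ 1 + ψ 2 = 0 := by
    have h : ∑ t : ZMod 3, ψ t = ψ 0 + ψ 1 + ψ 2 := Fin.sum_univ_three _
    rw [← hs, h, AddChar.map_zero_eq_one]
  have key := mac_prod ψ hψ Γ hsd (fun v => if v = 0 then x else y)
  have hin : ∀ t : ZMod 3, ∑ v : ZMod 3, ψ (v * t) * (if v = 0 then x else y) =
      if t = 0 then x + 2 * y else x - y := by
    intro t
    have h : ∑ v : ZMod 3, ψ (v * t) * (if v = 0 then x else y) =
      ψ (0 * t) * x + ψ (1 * t) * y + ψ (2 * t) * y := Fin.sum_univ_three _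
    rw [h]
    have h3 : t = 0 ∨ t = 1 ∨ t = 2 := by clear h; revert t; decide
    have e : (2 : ZMod 3) * 2 = 1 := by decide
    have e1 : (1 : ZMod 3) ≠ 0 := by decide
    have e2 : (2 : ZMod 3) ≠ 0 := by decide
    rcases h3 with rfl | rfl | rfl
    · simp; ring
    · simp only [zero_mul, one_mul, mul_one, AddChar.map_zero_eq_one, e1, if_false]
      linear_combination y * hs3
    · simp only [zero_mul, one_mul, e, AddChar.map_zero_eq_one, e2, if_false]
      linear_combination y * hs3
  simp_rw [hin, prod_wt] at key
  convert key

theorem deriv_pow_dvd {R : Type*} [CommRing R] [Algebra ℂ R] (D : Derivation ℂ R R) (p a : R)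
    (k : ℕ) (h : p ^ (k + 1) ∣ a) : p ^ k ∣ D a := by
  obtain ⟨q, rfl⟩ := h
  rw [Derivation.leibniz, Derivation.leibniz_pow]
  simp only [smul_eq_mul, Nat.add_sub_cancel, nsmul_eq_mul]
  exact ⟨p * D q + q * (((k + 1 : ℕ) : R) * D p), by ring⟩

local notation "RR" => MvPolynomial (Fin 2) ℂ

/-- First factor of the Duursma operator. -/
def opE : Derivation ℂ RR RR :=
  (2 : ℂ) • MvPolynomial.pderiv 0 - MvPolynomial.pderiv 1

/-- The operator `∂y (8 ∂x^3 - ∂y^3)`. -/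
def opD : RR →ₗ[ℂ] RR :=
  let u : RR →ₗ[ℂ] RR := (MvPolynomial.pderiv 0).toLinearMap
  let v : RR →ₗ[ℂ] RR := (MvPolynomial.pderiv 1).toLinearMap
  ((4 : ℂ) • (u ∘ₗ u) + (2 : ℂ) • (u ∘ₗ v) + v ∘ₗ v) ∘ₗ v ∘ₗ opE.toLinearMap

theorem opD_apply (f : RR) : opD f =
    (4 : ℂ) • MvPolynomial.pderiv 0 (MvPolynomial.pderiv 0 (MvPolynomial.pderiv 1 (opE f)))
    + (2 : ℂ) • MvPolynomial.pderiv 0 (MvPolynomial.pderiv 1 (MvPolynomial.pderiv 1 (opE f)))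
    + MvPolynomial.pderiv 1 (MvPolynomial.pderiv 1 (MvPolynomial.pderiv 1 (opE f))) := rfl

theorem opE_apply (f : RR) : opE f =
    (2 : ℂ) • MvPolynomial.pderiv 0 f - MvPolynomial.pderiv 1 f := rfl

theorem pd0 (a b : ℕ) : MvPolynomial.pderiv 0 ((MvPolynomial.X 0 ^ a * MvPolynomial.X 1 ^ b : RR)) =
    (a : ℂ) • (MvPolynomial.X 0 ^ (a - 1) * MvPolynomial.X 1 ^ b) := by
  rw [Derivation.leibniz, Derivation.leibniz_pow, Derivation.leibniz_pow]
  simp [MvPolynomial.pderiv_X, MvPolynomial.smul_eq_C_mul]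
  ring

theorem pd1 (a b : ℕ) : MvPolynomial.pderiv 1 ((MvPolynomial.X 0 ^ a * MvPolynomial.X 1 ^ b : RR)) =
    (b : ℂ) • (MvPolynomial.X 0 ^ a * MvPolynomial.X 1 ^ (b - 1)) := by
  rw [Derivation.leibniz, Derivation.leibniz_pow, Derivation.leibniz_pow]
  simp [MvPolynomial.pderiv_X, MvPolynomial.smul_eq_C_mul]
  ring

theorem opD_mono (a b : ℕ) : opD (MvPolynomial.X 0 ^ a * MvPolynomial.X 1 ^ b : RR) =
    (8 * b * (a * (a - 1 : ℕ) * (a - 2 : ℕ)) : ℂ) •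
      (MvPolynomial.X 0 ^ (a - 3) * MvPolynomial.X 1 ^ (b - 1)) -
    (b * (b - 1 : ℕ) * (b - 2 : ℕ) * (b - 3 : ℕ) : ℂ) •
      (MvPolynomial.X 0 ^ a * MvPolynomial.X 1 ^ (b - 4)) := by
  simp only [opD_apply, opE_apply, map_sub, map_smul, Derivation.map_smul, pd0, pd1, Nat.sub_sub,
    Nat.reduceAdd]
  simp only [MvPolynomial.smul_eq_C_mul, map_mul, map_ofNat]
  ring

theorem opD_dvd (f : RR) (p : RR) (k : ℕ) (h : p ^ (k + 3) ∣ opE f) : p ^ k ∣ opD f := by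
  rw [opD_apply]
  have hv := deriv_pow_dvd (MvPolynomial.pderiv 1) p _ _ h
  have huv := deriv_pow_dvd (MvPolynomial.pderiv 0) p _ _ hv
  have hvv := deriv_pow_dvd (MvPolynomial.pderiv 1) p _ _ hv
  refine dvd_add (dvd_add ?_ ?_) ?_
  · rw [MvPolynomial.smul_eq_C_mul]; exact (deriv_pow_dvd (MvPolynomial.pderiv 0) p _ _ huv).mul_left _
  · rw [MvPolynomial.smul_eq_C_mul]; exact (deriv_pow_dvd (MvPolynomial.pderiv 0) p _ _ hvv).mul_left _
  · exact deriv_pow_dvd (MvPolynomial.pderiv 1) p _ _ hvv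

/-- Dehomogenised image of a monomial under the operator. -/
def TT (n w : ℕ) : ℂ[X] :=
  C (8 * w * ((n - w : ℕ) * (n - w - 1 : ℕ) * (n - w - 2 : ℕ)) : ℂ) * X ^ (w - 1) -
    C (w * (w - 1 : ℕ) * (w - 2 : ℕ) * (w - 3 : ℕ) : ℂ) * X ^ (w - 4)

theorem TT_eq (n w : ℕ) : MvPolynomial.aeval (![1, X] : Fin 2 → ℂ[X])
    (opD (MvPolynomial.X 0 ^ (n - w) * MvPolynomial.X 1 ^ w : RR)) = TT n w := by
  rw [opD_mono]
  simp only [map_sub, map_smul, map_mul, map_pow, MvPolynomial.aeval_X, TT]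
  simp [Polynomial.smul_eq_C_mul]

theorem TT_natDegree (n w : ℕ) (hw : w ≤ n) : (TT n w).natDegree ≤ n - 4 := by
  unfold TT
  refine (natDegree_sub_le _ _).trans (max_le ?_ ?_)
  · by_cases h : w + 3 ≤ n ∧ 1 ≤ w
    · exact (natDegree_C_mul_X_pow_le _ _).trans (by omega)
    · have : (8 * w * ((n - w : ℕ) * (n - w - 1 : ℕ) * (n - w - 2 : ℕ)) : ℂ) = 0 := by
        have h : w = 0 ∨ n - w = 0 ∨ n - w - 1 = 0 ∨ n - w - 2 = 0 := by omega
        rcases h with h | h | h | h <;> simp [h]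
      rw [this]; simp
  · exact (natDegree_C_mul_X_pow_le _ _).trans (by omega)

theorem TT_zero (n : ℕ) : TT n 0 = 0 := by simp [TT]

theorem TT_comp (n w : ℕ) (hw : 3 ∣ w) (ω : ℂ) (hω : ω ^ 3 = 1) :
    (TT n w).comp (C ω * X) = C (ω ^ 2) * TT n w := by
  obtain ⟨j, rfl⟩ := hw
  have hC : (C ω : ℂ[X]) ^ 3 = 1 := by rw [← C_pow, hω, C_1]
  rcases j with _ | _ | j
  · simp [TT]
  · simp [TT]; ring
  · have e1 : 3 * (j + 1 + 1) - 1 = 3 * (j + 1) + 2 := by omega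
    have e2 : 3 * (j + 1 + 1) - 4 = 3 * j + 2 := by omega
    simp only [TT, e1, e2, sub_comp, mul_comp, C_comp, pow_comp, X_comp, mul_pow, pow_add, pow_mul, hC,
      one_pow, C_mul, C_pow]
    ring

theorem TT_coeff (n d w : ℕ) (hd : 4 ≤ d) (hw : d ≤ w) :
    (TT n w).coeff (d - 4) =
      if w = d then -(d * (d - 1 : ℕ) * (d - 2 : ℕ) * (d - 3 : ℕ) : ℂ) else 0 := by
  unfold TT
  rw [coeff_sub, coeff_C_mul_X_pow, coeff_C_mul_X_pow]
  have h1 : ¬ (d - 4 = w - 1) := by omega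
  rw [if_neg h1]
  by_cases h : w = d
  · subst h; simp
  · have h2 : ¬ (d - 4 = w - 4) := by omega
    simp [h, h2]

theorem TT_dvd (n d w : ℕ) (hw : d ≤ w) : X ^ (d - 4) ∣ TT n w := by
  unfold TT
  refine dvd_sub ?_ ?_
  · exact (pow_dvd_pow _ (by omega)).mul_left _
  · exact (pow_dvd_pow _ (by omega)).mul_left _

theorem main_bound {n d : ℕ} (Γ : Submodule (ZMod 3) (Fin n → ZMod 3))
    (hsd : Γ = dualCode Γ) (hd : 4 ≤ d) (hmin : ∀ c ∈ Γ, c ≠ 0 → d ≤ wt c)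
    (hex : ∃ c ∈ Γ, wt c = d) : 4 * (d - 4) ≤ n - 4 := by
  classical
  let A : RR := ∑ c : Γ, MvPolynomial.X 0 ^ (n - wt c.1) * MvPolynomial.X 1 ^ wt c.1
  let g : ℂ[X] := ∑ c : Γ, TT n (wt c.1)
  have hg : MvPolynomial.aeval (![1, X] : Fin 2 → ℂ[X]) (opD A) = g := by
    simp only [A, g, map_sum, TT_eq]
  have hN : (Fintype.card Γ : ℂ) ≠ 0 := by exact_mod_cast Fintype.card_ne_zero
  have hpos : ∀ c : Γ, wt c.1 = 0 ∨ d ≤ wt c.1 := by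
    intro c
    by_cases h : c.1 = 0
    · left; rw [wt_eq_card]; simp [h]
    · right; exact hmin _ c.2 h
  -- divisibility at 1
  have hE : (MvPolynomial.X 0 - MvPolynomial.X 1 : RR) ^ (d - 4 + 3) ∣ opE A := by
    have h1 := congrArg opE (mac_enum Γ hsd (MvPolynomial.X 0) (MvPolynomial.X 1))
    rw [map_sum] at h1
    have h2 : opE ((Fintype.card Γ : RR) * A) = MvPolynomial.C (Fintype.card Γ : ℂ) * opE A := by
      rw [← MvPolynomial.smul_eq_C_mul, ← Derivation.map_smul, MvPolynomial.smul_eq_C_mul]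
      simp
    rw [h2] at h1
    have h3 : (MvPolynomial.X 0 - MvPolynomial.X 1 : RR) ^ (d - 4 + 3) ∣
        MvPolynomial.C (Fintype.card Γ : ℂ) * opE A := by
      rw [← h1]
      refine Finset.dvd_sum fun c _ => ?_
      rcases hpos c with h | h
      · rw [h]
        have : opE ((MvPolynomial.X 0 + 2 * MvPolynomial.X 1 : RR) ^ (n - 0) *
            (MvPolynomial.X 0 - MvPolynomial.X 1) ^ 0) = 0 := by
          rw [pow_zero, mul_one, Derivation.leibniz_pow]
          have : opE (MvPolynomial.X 0 + 2 * MvPolynomial.X 1 : RR) = 0 := by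
            have e : (2 : RR) * MvPolynomial.X 1 = (2 : ℂ) • MvPolynomial.X 1 := by
              rw [MvPolynomial.smul_eq_C_mul, map_ofNat]
            rw [e, map_add, Derivation.map_smul, opE_apply, opE_apply]
            simp [MvPolynomial.pderiv_X]
          rw [this]; simp
        rw [this]; exact dvd_zero _
      · apply deriv_pow_dvd
        exact (pow_dvd_pow _ (by omega)).mul_left _
    have h4 : opE A = MvPolynomial.C ((Fintype.card Γ : ℂ)⁻¹) *
        (MvPolynomial.C (Fintype.card Γ : ℂ) * opE A) := by
      rw [← mul_assoc, ← MvPolynomial.C_mul, inv_mul_cancel₀ hN, MvPolynomial.C_1, one_mul]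
    rw [h4]
    exact h3.mul_left _
  have hD := opD_dvd A _ _ hE
  have h1 : (1 - X : ℂ[X]) ^ (d - 4) ∣ g := by
    have := map_dvd (MvPolynomial.aeval (![1, X] : Fin 2 → ℂ[X])) hD
    rw [hg] at this
    simpa using this
  have h0 : (X : ℂ[X]) ^ (d - 4) ∣ g := by
    refine Finset.dvd_sum fun c _ => ?_
    rcases hpos c with h | h
    · rw [h, TT_zero]; exact dvd_zero _
    · exact TT_dvd _ _ _ h
  have hgne : g ≠ 0 := by
    intro h
    have hc : g.coeff (d - 4) = 0 := by rw [h]; simp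
    have hc2 : g.coeff (d - 4) = ∑ c : Γ, if wt c.1 = d then
        -(d * (d - 1 : ℕ) * (d - 2 : ℕ) * (d - 3 : ℕ) : ℂ) else 0 := by
      simp only [g, finsetSum_coeff]
      refine Finset.sum_congr rfl fun c _ => ?_
      rcases hpos c with h | h
      · rw [h, TT_zero, if_neg (by omega)]; simp
      · exact TT_coeff _ _ _ hd h
    rw [hc2, ← Finset.sum_filter, Finset.sum_const, nsmul_eq_mul, mul_eq_zero] at hc
    rcases hc with hc | hc
    · obtain ⟨c, hc1, hc2⟩ := hex
      rw [Nat.cast_eq_zero, Finset.card_eq_zero, Finset.filter_eq_empty_iff] at hc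
      exact hc (Finset.mem_univ (⟨c, hc1⟩ : Γ)) hc2
    · rw [neg_eq_zero] at hc
      have : d * (d - 1) * (d - 2) * (d - 3) = 0 := by exact_mod_cast hc
      simp only [mul_eq_zero] at this
      omega
  have hdeg : g.natDegree ≤ n - 4 :=
    natDegree_sum_le_of_forall_le _ _ fun c _ => TT_natDegree _ _ (wt_le _)
  have hroot : ∀ ω : ℂ, ω ^ 3 = 1 → (X - C ω) ^ (d - 4) ∣ g := by
    intro ω hω
    have hω0 : ω ≠ 0 := by rintro rfl; norm_num at hω
    have hcomp : g.comp (C (ω ^ 2) * X) = C ((ω ^ 2) ^ 2) * g := by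
      simp only [g, ← coe_compRingHom_apply, map_sum, Finset.mul_sum]
      simp only [coe_compRingHom_apply]
      refine Finset.sum_congr rfl fun c _ => ?_
      exact TT_comp _ _ (three_dvd_wt Γ hsd _ c.2) _ (by rw [← pow_mul, mul_comm, pow_mul, hω, one_pow])
    have h2 := map_dvd (compRingHom (C (ω ^ 2) * X)) h1
    simp only [coe_compRingHom_apply, hcomp] at h2
    have e : (((1 : ℂ[X]) - X) ^ (d - 4)).comp (C (ω ^ 2) * X) =
        C ((-(ω ^ 2)) ^ (d - 4)) * (X - C ω) ^ (d - 4) := by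
      rw [pow_comp, C_pow (n := d - 4), ← mul_pow]
      congr 1
      have hC : (C ω : ℂ[X]) ^ 3 = 1 := by rw [← C_pow, hω, C_1]
      simp only [sub_comp, one_comp, X_comp, C_neg, C_pow]
      linear_combination -hC
    rw [e] at h2
    have h3 := (dvd_mul_left _ _).trans h2
    have hu : IsUnit (C ((ω ^ 2) ^ 2) : ℂ[X]) :=
      isUnit_C.2 (IsUnit.mk0 _ (pow_ne_zero _ (pow_ne_zero _ hω0)))
    exact (hu.dvd_mul_left).1 h3
  obtain ⟨ω, hω⟩ : ∃ ω : ℂ, IsPrimitiveRoot ω 3 :=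
    ⟨_, Complex.isPrimitiveRoot_exp 3 (by norm_num)⟩
  have hω3 := hω.pow_eq_one
  have hω0 : ω ≠ 0 := by rintro rfl; norm_num at hω3
  have hω1 : ω ≠ 1 := hω.ne_one (by norm_num)
  have hω2 : ω ^ 2 ≠ 1 := hω.pow_ne_one_of_pos_of_lt (by norm_num) (by norm_num)
  have hω4 : ω ^ 2 ≠ ω := by
    intro h
    apply hω1
    have : ω * ω = ω * 1 := by rw [mul_one, ← sq, h]
    exact mul_left_cancel₀ hω0 this
  let s : Finset ℂ := {0, 1, ω, ω ^ 2}
  have hs : s.card = 4 := by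
    simp only [s]
    rw [Finset.card_insert_of_notMem, Finset.card_insert_of_notMem, Finset.card_pair hω4.symm]
    · simp only [Finset.mem_insert, Finset.mem_singleton, not_or]
      exact ⟨hω1.symm, hω2.symm⟩
    · simp only [Finset.mem_insert, Finset.mem_singleton, not_or]
      exact ⟨zero_ne_one, hω0.symm, (pow_ne_zero 2 hω0).symm⟩
  have hprod : ∏ a ∈ s, (X - C a : ℂ[X]) ^ (d - 4) ∣ g := by
    apply Finset.prod_dvd_of_coprime
    · intro a _ b _ hab
      exact (isCoprime_X_sub_C_of_isUnit_sub (sub_ne_zero.2 hab).isUnit).pow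
    · intro a ha
      simp only [s, Finset.mem_insert, Finset.mem_singleton] at ha
      rcases ha with rfl | rfl | rfl | rfl
      · simpa using h0
      · exact hroot _ (by simp)
      · exact hroot _ hω3
      · exact hroot _ (by rw [← pow_mul, mul_comm, pow_mul, hω3, one_pow])
  have hle := natDegree_le_of_dvd hprod hgne
  rw [natDegree_prod_of_monic _ _ fun a _ => (monic_X_sub_C a).pow _] at hle
  simp only [natDegree_pow, natDegree_X_sub_C, mul_one, Finset.sum_const, hs, smul_eq_mul] at hle
  exact hle.trans hdeg

/-- Mallows–Sloane, Type III: a ternary self-dual code satisfies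
`d ≤ 3⌊n/12⌋ + 3`. -/
theorem stmt_14 {n : ℕ} (hn : 0 < n) (Γ : Submodule (ZMod 3) (Fin n → ZMod 3))
    (hsd : Γ = dualCode Γ) :
    minDist Γ ≤ 3 * (n / 12) + 3 := by
  by_contra hlt
  push Not at hlt
  have hne : {w | ∃ x ∈ Γ, x ≠ 0 ∧ wt x = w}.Nonempty := by
    by_contra h
    rw [Set.not_nonempty_iff_eq_empty] at h
    rw [minDist, h, Nat.sInf_empty] at hlt
    omega
  obtain ⟨x, hx, hx0, hxd⟩ := Nat.sInf_mem hne
  change wt x = minDist Γ at hxd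
  have h3 := three_dvd_wt Γ hsd x hx
  have hle := wt_le x
  have := main_bound (d := minDist Γ) Γ hsd (by omega)
    (fun c hc hc0 => Nat.sInf_le ⟨c, hc, hc0, rfl⟩) ⟨x, hx, hxd⟩
  omega

end
end

section
/- (Mallows–Sloane bound, Type IV) If C is a self-dual code of length n > 0 over F_4 (that is, C = C⊥ in F_4^n) in which every codeword has even Hamming weight, then its minimum distance satisfies d ≤ 2·⌊n/6⌋ + 2. -/
open Finset Polynomial

noncomputable section

variable {F : Type*} [Field F] [Fintype F] {ι : Type*} [Fintype ι]

section helpers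

variable {F : Type*} [Field F] [Fintype F]

theorem aux_two (hF : Fintype.card F = 4) : (2 : F) = 0 := by
  have h := FiniteField.cast_card_eq_zero F
  rw [hF] at h
  have h2 : (2 : F) * 2 = 0 := by
    rw [← h]; norm_num
  exact mul_self_eq_zero.mp h2

theorem aux_pow (hF : Fintype.card F = 4) (a : F) : a ^ 4 = a := by
  have := FiniteField.pow_card a
  rwa [hF] at this

theorem aux_cube (hF : Fintype.card F = 4) (a : F) (ha : a ≠ 0) : a ^ 3 = 1 := by
  have := aux_pow hF a
  have h : a * (a ^ 3 - 1) = 0 := by linear_combination this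
  rcases mul_eq_zero.mp h with h | h
  · exact absurd h ha
  · linear_combination h

theorem aux_omega (hF : Fintype.card F = 4) : ∃ w : F, w ^ 2 + w = 1 := by
  classical
  have : ∃ a : F, a ∉ ({0, 1} : Finset F) := by
    by_contra! h
    have h1 : (Finset.univ : Finset F) ⊆ {0, 1} := fun a _ => h a
    have h2 := Finset.card_le_card h1
    rw [Finset.card_univ, hF] at h2
    have h3 := Finset.card_le_two (a := (0 : F)) (b := 1)
    omega
  obtain ⟨a, ha⟩ := this
  simp only [Finset.mem_insert, Finset.mem_singleton, not_or] at ha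
  have h3 := aux_cube hF a ha.1
  have h : (a - 1) * (a ^ 2 + a + 1) = 0 := by linear_combination h3
  rcases mul_eq_zero.mp h with h | h
  · exact absurd (sub_eq_zero.mp h) ha.2
  · exact ⟨a, by linear_combination h - aux_two hF⟩

theorem aux_wt {n : ℕ} (x : Fin n → F) [DecidableEq F] :
    wt x = ∑ i, if x i ≠ 0 then 1 else 0 := by
  rw [wt, ← Finset.card_filter, ← Set.ncard_coe_finset]
  simp

theorem aux_wt_cast (hF : Fintype.card F = 4) {n : ℕ} (x : Fin n → F) :
    (wt x : F) = ∑ i, x i ^ 3 := by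
  classical
  rw [aux_wt]
  push_cast
  refine Finset.sum_congr rfl fun i _ => ?_
  by_cases h : x i = 0
  · simp [h]
  · simp [h, aux_cube hF _ h]

theorem aux_even (hF : Fintype.card F = 4) {n : ℕ} (x : Fin n → F) (h : Even (wt x)) :
    ∑ i, x i ^ 3 = 0 := by
  rw [← aux_wt_cast hF]
  obtain ⟨m, hm⟩ := h
  rw [hm]
  push_cast
  linear_combination (m : F) * aux_two hF

theorem aux_conj (hF : Fintype.card F = 4) {n : ℕ} (Γ : Submodule F (Fin n → F))
    (hsd : Γ = dualCode Γ) (hdiv : ∀ x ∈ Γ, Even (wt x)) (x : Fin n → F) (hx : x ∈ Γ) :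
    (x ^ 2 : Fin n → F) ∈ Γ := by
  rw [hsd]
  intro c hc
  obtain ⟨w, hw⟩ := aux_omega hF
  have two := aux_two hF
  have key : ∀ a : F, a * ∑ i, x i ^ 2 * c i + a ^ 2 * ∑ i, x i * c i ^ 2 = 0 := by
    intro a
    have h1 := aux_even hF _ (hdiv _ (Γ.add_mem hx (Γ.smul_mem a hc)))
    have h2 := aux_even hF _ (hdiv _ hx)
    have h3 := aux_even hF _ (hdiv _ hc)
    have e : ∑ i, (x + a • c) i ^ 3 = ∑ i, x i ^ 3 + a ^ 3 * ∑ i, c i ^ 3 +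
        3 * (a * ∑ i, x i ^ 2 * c i + a ^ 2 * ∑ i, x i * c i ^ 2) := by
      simp only [Finset.mul_sum, ← Finset.sum_add_distrib]
      refine Finset.sum_congr rfl fun i _ => ?_
      simp only [Pi.add_apply, Pi.smul_apply, smul_eq_mul]
      ring
    rw [h1, h2, h3] at e
    linear_combination -e -
      (a * ∑ i, x i ^ 2 * c i + a ^ 2 * ∑ i, x i * c i ^ 2) * two
  have k1 := key 1
  have k2 := key w
  simp only [Pi.pow_apply]
  generalize ∑ i, x i ^ 2 * c i = P at *
  generalize ∑ i, x i * c i ^ 2 = Q at *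
  linear_combination w ^ 2 * k1 - k2 - P * hw + w * P * two

theorem aux_finrank {n : ℕ} (Γ : Submodule F (Fin n → F)) (hsd : Γ = dualCode Γ) :
    2 * Module.finrank F Γ = n := by
  let B : LinearMap.BilinForm F (Fin n → F) := dotProductBilin F F
  have h := LinearMap.BilinForm.finrank_add_finrank_orthogonal' (B := B) Γ
  have hk : LinearMap.ker B = ⊥ := by
    rw [LinearMap.ker_eq_bot']
    intro m hm
    exact dotProduct_eq_zero m fun w => congrArg (fun f => f w) hm
  have ho : B.orthogonal Γ = Γ := by
    conv_rhs => rw [hsd]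
    ext x
    rw [LinearMap.BilinForm.mem_orthogonal_iff]
    refine forall₂_congr fun c _ => ?_
    change (∑ i, c i * x i = 0) ↔ (∑ i, x i * c i = 0)
    simp only [mul_comm]
  rw [hk, inf_bot_eq, finrank_bot, ho, Module.finrank_fin_fun] at h
  omega

theorem aux_fixed (hF : Fintype.card F = 4) {n : ℕ} (D p : Submodule F (Fin n → F))
    (hD : ∀ x ∈ D, (x ^ 2 : Fin n → F) ∈ D)
    (hlt : Module.finrank F p < Module.finrank F D) :
    ∃ v ∈ D, v ∉ p ∧ ∀ i, v i ^ 2 = v i := by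
  obtain ⟨w, hw⟩ := aux_omega hF
  have two := aux_two hF
  have hy : ∃ y ∈ D, y ∉ p := by
    by_contra! h
    have := Submodule.finrank_mono (show D ≤ p from h)
    omega
  obtain ⟨y, hyD, hyp⟩ := hy
  have fix : ∀ z : Fin n → F, ∀ i, (z + z ^ 2) i ^ 2 = (z + z ^ 2) i := by
    intro z i
    simp only [Pi.add_apply, Pi.pow_apply]
    linear_combination aux_pow hF (z i) + z i ^ 3 * two
  by_cases h1 : y + y ^ 2 ∈ p
  · refine ⟨w • y + (w • y) ^ 2, D.add_mem (D.smul_mem _ hyD) (hD _ (D.smul_mem _ hyD)),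
      fun h2 => hyp ?_, fix _⟩
    have h3 := p.add_mem h2 (p.smul_mem (w ^ 2) h1)
    convert h3 using 1
    ext i
    simp only [Pi.add_apply, Pi.pow_apply, Pi.smul_apply, smul_eq_mul]
    linear_combination (-(y i)) * hw - w ^ 2 * y i ^ 2 * two
  · exact ⟨_, D.add_mem hyD (hD _ hyD), h1, fix y⟩

theorem aux_minDist_le {n : ℕ} (Γ : Submodule F (Fin n → F)) (x : Fin n → F) (hx : x ∈ Γ)
    (h0 : x ≠ 0) : minDist Γ ≤ wt x :=
  Nat.sInf_le ⟨x, hx, h0, rfl⟩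

theorem aux_triple (hF : Fintype.card F = 4) {n k : ℕ} (hk : k ≤ n) (u v : Fin n → F)
    (hu : ∀ i, u i ^ 2 = u i) (hv : ∀ i, v i ^ 2 = v i)
    (hu0 : ∀ i : Fin n, (i : ℕ) < k → u i = 0) (hv0 : ∀ i : Fin n, (i : ℕ) < k → v i = 0) :
    wt u + wt v + wt (u + v) + 2 * k ≤ 2 * n := by
  classical
  have b : ∀ a : F, a ^ 2 = a → a = 0 ∨ a = 1 := by
    intro a ha
    have : a * (a - 1) = 0 := by linear_combination ha
    rcases mul_eq_zero.mp this with h | h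
    · exact Or.inl h
    · exact Or.inr (sub_eq_zero.mp h)
  have hc : k = ∑ i : Fin n, if (i : ℕ) < k then 1 else 0 := by
    rw [← Finset.card_filter, Fin.card_filter_val_lt]
    omega
  have hn : 2 * n = ∑ i : Fin n, 2 := by simp [mul_comm]
  have two : (1 : F) + 1 = 0 := by linear_combination aux_two hF
  rw [hn, aux_wt, aux_wt, aux_wt]
  conv_lhs => rw [hc]
  rw [Finset.mul_sum, ← Finset.sum_add_distrib, ← Finset.sum_add_distrib,
    ← Finset.sum_add_distrib]
  refine Finset.sum_le_sum fun i _ => ?_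
  by_cases hi : (i : ℕ) < k
  · simp [hu0 i hi, hv0 i hi, hi]
  · rcases b _ (hu i) with h | h <;> rcases b _ (hv i) with h' | h' <;> simp [h, h', hi, two]

end helpers

/-- Mallows–Sloane, Type IV: a self-dual code over `F₄` with all
weights even satisfies `d ≤ 2⌊n/6⌋ + 2`. -/
theorem stmt_15 {F : Type*} [Field F] [Fintype F] (hF : Fintype.card F = 4)
    {n : ℕ} (hn : 0 < n) (Γ : Submodule F (Fin n → F))
    (hsd : Γ = dualCode Γ) (hdiv : ∀ x ∈ Γ, Even (wt x)) :
    minDist Γ ≤ 2 * (n / 6) + 2 := by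
  have hk := aux_finrank Γ hsd
  set k := Module.finrank F Γ with hkdef
  have two := aux_two hF
  by_cases hk2 : k ≤ 1
  · obtain ⟨v, hv, hv0, -⟩ := aux_fixed hF Γ ⊥ (aux_conj hF Γ hsd hdiv)
      (by rw [finrank_bot]; omega)
    have h1 := aux_minDist_le Γ v hv hv0
    have h2 : wt v ≤ n := by
      classical
      rw [aux_wt, ← Finset.card_filter]
      exact (Finset.card_le_univ _).trans (by simp)
    omega
  -- the shortened code: codewords vanishing on the first `k - 2` coordinates
  let g : (Fin n → F) →ₗ[F] (Fin (k - 2) → F) :=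
    LinearMap.funLeft F F (Fin.castLE (by omega))
  let D : Submodule F (Fin n → F) := Γ ⊓ LinearMap.ker g
  have hDrank : 2 ≤ Module.finrank F D := by
    have h1 := LinearMap.finrank_range_add_finrank_ker (g.domRestrict Γ)
    have h2 := Submodule.finrank_le (LinearMap.range (g.domRestrict Γ))
    rw [Module.finrank_fin_fun] at h2
    have h3 : Module.finrank F (LinearMap.ker (g.domRestrict Γ)) ≤ Module.finrank F D := by
      rw [← Submodule.finrank_map_subtype_eq Γ]
      apply Submodule.finrank_mono
      rintro _ ⟨⟨x, hx⟩, hx', rfl⟩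
      exact ⟨hx, hx'⟩
    omega
  have hDz : ∀ x ∈ D, ∀ i : Fin n, (i : ℕ) < k - 2 → x i = 0 := by
    intro x hx i hi
    exact congrFun (LinearMap.mem_ker.mp hx.2) ⟨i, hi⟩
  have hDc : ∀ x ∈ D, (x ^ 2 : Fin n → F) ∈ D := by
    intro x hx
    refine ⟨aux_conj hF Γ hsd hdiv x hx.1, LinearMap.mem_ker.mpr ?_⟩
    ext j
    have := hDz x hx (Fin.castLE (by omega) j) j.2
    simp [g, LinearMap.funLeft_apply, this]
  obtain ⟨u, huD, hu0, hu⟩ := aux_fixed hF D ⊥ hDc (by rw [finrank_bot]; omega)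
  have hu0' : u ≠ 0 := hu0
  obtain ⟨v, hvD, hvu, hv⟩ := aux_fixed hF D (F ∙ u) hDc
    (by rw [finrank_span_singleton hu0']; omega)
  have hv0 : v ≠ 0 := by
    rintro rfl
    exact hvu (Submodule.zero_mem _)
  have huv : u + v ≠ 0 := by
    intro h
    apply hvu
    rw [eq_neg_of_add_eq_zero_right h]
    exact Submodule.neg_mem _ (Submodule.mem_span_singleton_self u)
  have m1 := aux_minDist_le Γ u huD.1 hu0'
  have m2 := aux_minDist_le Γ v hvD.1 hv0
  have m3 := aux_minDist_le Γ (u + v) (Γ.add_mem huD.1 hvD.1) huv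
  have ht := aux_triple hF (k := k - 2) (by omega) u v hu hv (hDz u huD) (hDz v hvD)
  have hev : Even (minDist Γ) := by
    have hne : {w | ∃ x ∈ Γ, x ≠ 0 ∧ wt x = w}.Nonempty := ⟨_, u, huD.1, hu0', rfl⟩
    obtain ⟨x, hx, -, hxw⟩ := Nat.sInf_mem hne
    have := hdiv x hx
    rw [hxw] at this
    exact this
  obtain ⟨e, he⟩ := hev
  omega

end
end

section
/- (Normalized Greene congruence) The following congruence of polynomials in ℚ[t] holds: ( Σ_{i=0}^{n} (A_i / binom(n,i)) · t^i ) · (1+t)^{n+1} ≡ Σ_{S ⊆ {1,…,n}} (1 / binom(n,|S|)) · q^{k − r(S)} · t^{n−|S|} · (1+t)^{|S|} (mod t^{n+1}). -/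
open Finset Polynomial

noncomputable section

variable {F : Type*} [Field F] [Fintype F] {ι : Type*} [Fintype ι]

theorem greene_G_step (n w : ℕ) :
    (∑ j ∈ Finset.range (n + 2), ((j.choose (w+1) : ℕ) : ℚ[X]) * X ^ j * (1 + X) ^ (n + 1 - j))
      = X * (1 + X) * (∑ j ∈ Finset.range (n + 1),
          ((j.choose w : ℕ) : ℚ[X]) * X ^ j * (1 + X) ^ (n - j))
        - (((n+1).choose (w+1) : ℕ) : ℚ[X]) * X ^ (n + 2) := by
  have key : ∀ (m v : ℕ), (∑ j ∈ Finset.range (m + 2),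
      ((j.choose v : ℕ) : ℚ[X]) * X ^ j * (1 + X) ^ (m + 1 - j))
      = (1 + X) * (∑ j ∈ Finset.range (m + 1),
          ((j.choose v : ℕ) : ℚ[X]) * X ^ j * (1 + X) ^ (m - j))
        + (((m+1).choose v : ℕ) : ℚ[X]) * X ^ (m + 1) := by
    intro m v
    rw [Finset.sum_range_succ, Finset.mul_sum]
    congr 1
    · refine Finset.sum_congr rfl fun j hj => ?_
      have : m + 1 - j = (m - j) + 1 := by
        have := Finset.mem_range.1 hj
        omega
      rw [this]; ring
    · simp
  induction n with
  | zero =>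
    rw [key]
    cases w <;> simp [Nat.choose_succ_succ]
    ring
  | succ n ih =>
    rw [key, ih, key n w, Nat.choose_succ_succ (n+1) w]
    push_cast
    ring

theorem greene_G_dvd (n w : ℕ) :
    (X : ℚ[X]) ^ (n + 1) ∣ X ^ w * (1 + X) ^ (n + 1) -
      ∑ j ∈ Finset.range (n + 1), ((j.choose w : ℕ) : ℚ[X]) * X ^ j * (1 + X) ^ (n - j) := by
  induction w generalizing n with
  | zero =>
    have h := (Commute.all (X : ℚ[X]) (1 + X)).geom_sum₂_mul (n + 1)
    have h2 : (∑ j ∈ Finset.range (n + 1),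
        ((j.choose 0 : ℕ) : ℚ[X]) * X ^ j * (1 + X) ^ (n - j)) =
        (1 + X) ^ (n + 1) - X ^ (n + 1) := by
      simp at h ⊢
      linear_combination -h
    rw [h2]
    exact ⟨1, by ring⟩
  | succ w ih =>
    cases n with
    | zero => exact ⟨X ^ w * (1 + X), by simp; ring⟩
    | succ n =>
      rw [greene_G_step]
      obtain ⟨p, hp⟩ := ih n
      refine ⟨(1 + X) * p + (((n+1).choose (w+1) : ℕ) : ℚ[X]), ?_⟩
      linear_combination X * (1 + X) * hp

theorem greene_card {F : Type*} [Field F] [Fintype F] {n : ℕ}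
    (Γ : Submodule F (Fin n → F)) [Fintype Γ] [DecidableEq F] (S : Finset (Fin n)) :
    Fintype.card F ^ (Module.finrank F Γ - projRank Γ S) =
      (Finset.univ.filter fun c : Γ => ∀ i ∈ S, c.1 i = 0).card := by
  classical
  let f : Γ →ₗ[F] ({i // i ∈ S} → F) :=
    (LinearMap.funLeft F F (Subtype.val : {i // i ∈ S} → Fin n)).comp Γ.subtype
  have hr : projRank Γ S = Module.finrank F (LinearMap.range f) := by
    unfold projRank
    rw [LinearMap.range_comp, Submodule.range_subtype]
  have h1 := LinearMap.finrank_range_add_finrank_ker f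
  have h2 : Module.finrank F Γ - projRank Γ S = Module.finrank F (LinearMap.ker f) := by omega
  rw [h2, ← Module.card_eq_pow_finrank (K := F) (V := LinearMap.ker f), Fintype.card_subtype]
  congr 1
  ext c
  simp only [Finset.mem_filter, Finset.mem_univ, true_and, LinearMap.mem_ker]
  constructor
  · intro h i hi
    exact congrFun h ⟨i, hi⟩
  · intro h
    funext i
    exact h i.1 i.2

theorem greene_binom (n w s : ℕ) (hw : w ≤ n) (hs : s ≤ n) :
    ((n - w).choose s : ℚ) / (n.choose s : ℚ) = ((n - s).choose w : ℚ) / (n.choose w : ℚ) := by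
  have h1 : (n.choose s : ℚ) ≠ 0 := by exact_mod_cast (Nat.choose_pos hs).ne'
  have h2 : (n.choose w : ℚ) ≠ 0 := by exact_mod_cast (Nat.choose_pos hw).ne'
  rw [div_eq_div_iff h1 h2]
  norm_cast
  by_cases h : s + w ≤ n
  · have e1 := Nat.choose_mul (n := n) (k := s + w) (s := w) (by omega)
    have e2 := Nat.choose_mul (n := n) (k := s + w) (s := s) (by omega)
    have e3 : (s + w).choose w = (s + w).choose s := by
      rw [Nat.choose_symm_add]
    rw [e3] at e1
    rw [Nat.add_sub_cancel] at e1
    rw [Nat.add_sub_cancel_left] at e2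
    linarith
  · rw [Nat.choose_eq_zero_of_lt (by omega : n - w < s),
      Nat.choose_eq_zero_of_lt (by omega : n - s < w)]
    simp

/-- The contribution of one zero set to the right-hand side. -/
theorem greene_inner {n w : ℕ} (hw : w ≤ n) (Z : Finset (Fin n)) (hZ : Z.card = n - w) :
    ∑ S ∈ Z.powerset, Polynomial.C (1 / (n.choose S.card : ℚ)) *
        X ^ (n - S.card) * (1 + X) ^ S.card =
      Polynomial.C (1 / (n.choose w : ℚ)) *
        ∑ j ∈ Finset.range (n + 1), ((j.choose w : ℕ) : ℚ[X]) * X ^ j * (1 + X) ^ (n - j) := by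
  rw [Finset.sum_powerset_apply_card (fun m => Polynomial.C (1 / (n.choose m : ℚ)) *
        X ^ (n - m) * (1 + X) ^ m), hZ]
  rw [Finset.sum_subset (s₂ := Finset.range (n + 1))]
  · rw [← Finset.sum_range_reflect _ (n + 1), Finset.mul_sum]
    refine Finset.sum_congr rfl fun j hj => ?_
    have hj' := Finset.mem_range.1 hj
    have e1 : n + 1 - 1 - j = n - j := by omega
    have e2 : n - (n - j) = j := by omega
    simp only [e1, e2]
    have hb := greene_binom n w (n - j) hw (by omega)
    rw [e2] at hb
    have hC := congrArg (Polynomial.C : ℚ → ℚ[X]) hb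
    simp only [div_eq_mul_inv, map_mul, map_natCast, one_mul, nsmul_eq_mul] at hC ⊢
    linear_combination (X ^ j * (1 + X) ^ (n - j)) * hC
  · intro x hx
    simp only [Finset.mem_range] at hx ⊢
    omega
  · intro x _ hx
    rw [Nat.choose_eq_zero_of_lt (by simp at hx; omega), zero_smul]

/-- normalized version of Greene's theorem, as a congruence of
polynomials in `ℚ[t]` modulo `t^(n+1)`. -/
theorem stmt_16 {F : Type*} [Field F] [Fintype F] {n : ℕ}
    (Γ : Submodule F (Fin n → F))
    (q k : ℕ) (hq : q = Fintype.card F) (hk : k = Module.finrank F Γ) :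
    (X : ℚ[X]) ^ (n + 1) ∣
      (∑ i ∈ Finset.range (n + 1),
          Polynomial.C ((wtCount Γ i : ℚ) / (n.choose i : ℚ)) * X ^ i) *
            (1 + X) ^ (n + 1)
        - ∑ S ∈ (Finset.univ : Finset (Fin n)).powerset,
            Polynomial.C ((1 / (n.choose S.card : ℚ)) * (q : ℚ) ^ (k - projRank Γ S)) *
              X ^ (n - S.card) * (1 + X) ^ S.card := by
  classical
  subst hq hk
  have : Fintype Γ := Fintype.ofFinite Γ
  let Z : Γ → Finset (Fin n) := fun c => Finset.univ.filter fun i => c.1 i = 0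
  have hwt : ∀ c : Γ, wt c.1 + (Z c).card = n := by
    intro c
    have : wt c.1 = (Finset.univ.filter fun i => ¬ c.1 i = 0).card := by
      unfold wt
      rw [← Set.ncard_coe_finset]
      congr 1
      ext i
      simp
    have h := Finset.card_filter_add_card_filter_not (s := (Finset.univ : Finset (Fin n)))
      (fun i => c.1 i = 0)
    rw [Finset.card_univ, Fintype.card_fin] at h
    rw [this]
    show _ + (Finset.univ.filter fun i => c.1 i = 0).card = n
    omega
  have hL : (∑ i ∈ Finset.range (n + 1),
      Polynomial.C ((wtCount Γ i : ℚ) / (n.choose i : ℚ)) * X ^ i) =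
      ∑ c : Γ, Polynomial.C (1 / (n.choose (wt c.1) : ℚ)) * X ^ (wt c.1) := by
    rw [← Finset.sum_fiberwise_of_maps_to (s := Finset.univ) (t := Finset.range (n + 1))
      (g := fun c : Γ => wt c.1) (fun c _ => Finset.mem_range.2 (by have := hwt c; omega))]
    refine Finset.sum_congr rfl fun i _ => ?_
    have hcount : wtCount Γ i = (Finset.univ.filter fun c : Γ => wt c.1 = i).card := by
      unfold wtCount
      rw [← Set.ncard_coe_finset, ← Set.ncard_image_of_injective _ Subtype.val_injective]
      congr 1
      ext x
      simp
      tauto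
    rw [Finset.sum_congr rfl (g := fun _ => Polynomial.C (1 / (n.choose i : ℚ)) * X ^ i)
      (fun c hc => by rw [(Finset.mem_filter.1 hc).2]), Finset.sum_const, hcount,
      nsmul_eq_mul, div_eq_mul_one_div, map_mul, map_natCast, mul_assoc]
  have hR : (∑ S ∈ (Finset.univ : Finset (Fin n)).powerset,
      Polynomial.C ((1 / (n.choose S.card : ℚ)) *
        ((Fintype.card F : ℕ) : ℚ) ^ (Module.finrank F Γ - projRank Γ S)) *
              X ^ (n - S.card) * (1 + X) ^ S.card) =
      ∑ c : Γ, ∑ S ∈ (Z c).powerset, Polynomial.C (1 / (n.choose S.card : ℚ)) *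
        X ^ (n - S.card) * (1 + X) ^ S.card := by
    have h1 : ∀ c : Γ, (Z c).powerset =
        (Finset.univ : Finset (Fin n)).powerset.filter fun S => ∀ i ∈ S, c.1 i = 0 := by
      intro c
      ext S
      simp [Z, Finset.subset_iff]
    simp only [h1, Finset.sum_filter]
    rw [Finset.sum_comm]
    refine Finset.sum_congr rfl fun S _ => ?_
    rw [← Finset.sum_filter, Finset.sum_const, ← greene_card Γ S, nsmul_eq_mul, map_mul]
    push_cast
    simp only [map_pow, map_natCast]
    ring
  rw [hL, hR, Finset.sum_mul, ← Finset.sum_sub_distrib]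
  refine Finset.dvd_sum fun c _ => ?_
  have hc := hwt c
  rw [greene_inner (w := wt c.1) (by omega) (Z c) (by omega), mul_assoc, ← mul_sub]
  exact Dvd.dvd.mul_left (greene_G_dvd n (wt c.1)) _

end
end

section
/- Suppose C is self-dual, i.e. C = C⊥ in F_q^n. For a subset S ⊆ {1,…,n} with complement S̄, let C₁ = {c ∈ C : supp(c) ⊆ S} and C₂ = {c ∈ C : supp(c) ⊆ S̄}. Then 2·r(S) = |S| holds if and only if C is the internal direct sum of C₁ and C₂, the image of C₁ under the projection to the coordinates in S is a self-dual code in F_q^S, and the image of C₂ under the projection to the coordinates in S̄ is a self-dual code in F_q^{S̄}. -/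
open Finset Polynomial

noncomputable section

variable {F : Type*} [Field F] [Fintype F] {ι : Type*} [Fintype ι]

theorem finrank_dualCode_aux {F : Type*} [Field F] [Fintype F] {ι : Type*} [Fintype ι]
    (P : Submodule F (ι → F)) :
    Module.finrank F P + Module.finrank F (dualCode P) = Fintype.card ι := by
  classical
  have h : dualCode P = P.dualAnnihilator.comap (dotProductEquiv F ι).toLinearMap := by
    ext x
    simp only [Submodule.mem_comap, Submodule.mem_dualAnnihilator]
    rfl
  have h2 : Module.finrank F (dualCode P) = Module.finrank F P.dualAnnihilator := by
    rw [h]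
    exact ((dotProductEquiv F ι).ofSubmodule' P.dualAnnihilator).finrank_eq
  rw [h2, Subspace.finrank_add_finrank_dualAnnihilator_eq, Module.finrank_fintype_fun_eq_card]

theorem map_supp_eq_dual_aux {F : Type*} [Field F] [Fintype F] {n : ℕ}
    (Γ : Submodule F (Fin n → F)) (hsd : Γ = dualCode Γ) (S : Finset (Fin n)) :
    (Γ ⊓ supportedOn F S).map
           (LinearMap.funLeft F F (Subtype.val : {i // i ∈ S} → Fin n)) =
      dualCode (Γ.map (LinearMap.funLeft F F (Subtype.val : {i // i ∈ S} → Fin n))) := by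
  have key : ∀ x ∈ supportedOn F S, ∀ c : Fin n → F,
      ∑ i, x i * c i = ∑ i : {i // i ∈ S}, x i * c i := by
    intro x hx c
    rw [Finset.sum_coe_sort S (fun i => x i * c i)]
    symm
    apply Finset.sum_subset (Finset.subset_univ _)
    intro i _ hi
    rw [hx i hi, zero_mul]
  ext y
  constructor
  · rintro ⟨x, ⟨hx1, hx2⟩, rfl⟩
    rintro _ ⟨c, hc, rfl⟩
    have hx1' : x ∈ dualCode Γ := hsd ▸ hx1
    have h := hx1' c hc
    rw [key x hx2] at h
    exact h
  · intro hy
    let x : Fin n → F := fun i => if h : i ∈ S then y ⟨i, h⟩ else 0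
    have hxs : x ∈ supportedOn F S := fun i hi => by simp [x, hi]
    have hxy : ∀ i : {i // i ∈ S}, x i = y i := fun i => by simp [x]
    refine ⟨x, ⟨?_, hxs⟩, funext hxy⟩
    have : x ∈ dualCode Γ := by
      intro c hc
      rw [key x hxs]
      simp only [hxy]
      exact hy _ ⟨c, hc, rfl⟩
    rw [hsd]; exact this

/-- for a self-dual code, `2·r(S) = |S|` iff the code splits as a
direct sum of self-dual codes supported on `S` and its complement. -/
theorem stmt_19 {F : Type*} [Field F] [Fintype F] {n : ℕ}
    (Γ : Submodule F (Fin n → F)) (hsd : Γ = dualCode Γ)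
    (S : Finset (Fin n)) :
    2 * projRank Γ S = S.card ↔
      ((Γ ⊓ supportedOn F S) ⊓ (Γ ⊓ supportedOn F Sᶜ) = ⊥ ∧
       (Γ ⊓ supportedOn F S) ⊔ (Γ ⊓ supportedOn F Sᶜ) = Γ ∧
       (Γ ⊓ supportedOn F S).map
           (LinearMap.funLeft F F (Subtype.val : {i // i ∈ S} → Fin n)) =
         dualCode ((Γ ⊓ supportedOn F S).map
           (LinearMap.funLeft F F (Subtype.val : {i // i ∈ S} → Fin n))) ∧
       (Γ ⊓ supportedOn F Sᶜ).map
           (LinearMap.funLeft F F (Subtype.val : {i // i ∈ Sᶜ} → Fin n)) =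
         dualCode ((Γ ⊓ supportedOn F Sᶜ).map
           (LinearMap.funLeft F F (Subtype.val : {i // i ∈ Sᶜ} → Fin n)))) := by
  have kS := map_supp_eq_dual_aux Γ hsd S
  have kT := map_supp_eq_dual_aux Γ hsd Sᶜ
  have hdim := finrank_dualCode_aux
    (Γ.map (LinearMap.funLeft F F (Subtype.val : {i // i ∈ S} → Fin n)))
  rw [← kS, Fintype.card_coe] at hdim
  have hle : (Γ ⊓ supportedOn F S).map
      (LinearMap.funLeft F F (Subtype.val : {i // i ∈ S} → Fin n)) ≤
      Γ.map (LinearMap.funLeft F F (Subtype.val : {i // i ∈ S} → Fin n)) :=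
    Submodule.map_mono inf_le_left
  unfold projRank
  constructor
  · intro h
    have hQP := Submodule.eq_of_le_of_finrank_eq hle (by omega)
    have hsup : (Γ ⊓ supportedOn F S) ⊔ (Γ ⊓ supportedOn F Sᶜ) = Γ := by
      apply le_antisymm (sup_le inf_le_left inf_le_left)
      intro c hc
      have hm : LinearMap.funLeft F F (Subtype.val : {i // i ∈ S} → Fin n) c ∈
          (Γ ⊓ supportedOn F S).map
            (LinearMap.funLeft F F (Subtype.val : {i // i ∈ S} → Fin n)) := by
        rw [hQP]; exact ⟨c, hc, rfl⟩
      obtain ⟨c1, hc1, he⟩ := hm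
      refine Submodule.mem_sup.2 ⟨c1, hc1, c - c1, ⟨Γ.sub_mem hc hc1.1, ?_⟩, by simp⟩
      intro i hi
      have hi' : i ∈ S := by simpa using hi
      have h3 : c1 i = c i := congrFun he ⟨i, hi'⟩
      simp [h3]
    refine ⟨?_, hsup, ?_, ?_⟩
    · rw [eq_bot_iff]
      rintro x ⟨⟨_, h1⟩, ⟨_, h2⟩⟩
      rw [Submodule.mem_bot]
      funext i
      by_cases hi : i ∈ S
      · exact h2 i (by simpa using hi)
      · exact h1 i hi
    · rw [← hQP] at kS
      exact kS
    · have hT : (Γ ⊓ supportedOn F Sᶜ).map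
          (LinearMap.funLeft F F (Subtype.val : {i // i ∈ Sᶜ} → Fin n)) =
          Γ.map (LinearMap.funLeft F F (Subtype.val : {i // i ∈ Sᶜ} → Fin n)) := by
        apply le_antisymm (Submodule.map_mono inf_le_left)
        rintro _ ⟨c, hc, rfl⟩
        have hc' : c ∈ (Γ ⊓ supportedOn F S) ⊔ (Γ ⊓ supportedOn F Sᶜ) := by
          rw [hsup]; exact hc
        obtain ⟨a, ha, b, hb, rfl⟩ := Submodule.mem_sup.1 hc'
        refine ⟨b, hb, ?_⟩
        funext i
        have : a i = 0 := ha.2 i (Finset.mem_compl.1 i.2)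
        simp [LinearMap.funLeft_apply, this]
      rw [← hT] at kT
      exact kT
  · rintro ⟨_, _, h, _⟩
    have h1 := finrank_dualCode_aux ((Γ ⊓ supportedOn F S).map
      (LinearMap.funLeft F F (Subtype.val : {i // i ∈ S} → Fin n)))
    rw [← h, Fintype.card_coe] at h1
    omega
end
end
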